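/- Suppose f(z|τ) is an entire function of the complex variable z that is even in z and satisfies f(z|τ) = f(z+π|τ) and f(z|τ) = q⁴ e^{16iz} f(z+πτ|τ) for all z ∈ ℂ, and suppose f(0|τ) ≠ 0. Then (8L(τ) + 3(log f)''(0|τ))² + 8M(τ) + 3(log f)⁽⁴⁾(0|τ) = (72 θ₁'(τ)⁴ / f(0|τ)) · [ f(π/2|τ)/θ₂(τ)⁴ − q·f((π+πτ)/2|τ)/θ₃(τ)⁴ + q·f(πτ/2|τ)/θ₄(τ)⁴ ], where (log f)''(0|τ) and (log f)⁽⁴⁾(0|τ) denote the second and fourth derivatives in z at z = 0 of a branch of log f(z|τ) defined near z = 0. -/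

import Mathlib

noncomputable section

open Complex

namespace Liu

/-- `π` as a complex number. -/
def piC : ℂ := Real.pi

/-- The nome `q = exp(2πiτ)`. -/
def qq (τ : ℂ) : ℂ := exp (2 * piC * I * τ)

/-- Jacobi theta function θ₁(z|τ). -/
def theta1 (z τ : ℂ) : ℂ :=
  -I * exp (piC * I * τ / 4) *
    ∑' n : ℤ, (-1 : ℂ) ^ n * exp (piC * I * τ * (n : ℂ) * ((n : ℂ) + 1)) *
      exp ((2 * (n : ℂ) + 1) * I * z)

/-- Jacobi theta function θ₂(z|τ). -/
def theta2 (z τ : ℂ) : ℂ :=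
  2 * ∑' n : ℕ, exp (piC * I * τ * (2 * (n : ℂ) + 1) ^ 2 / 4) * cos ((2 * (n : ℂ) + 1) * z)

/-- Jacobi theta function θ₃(z|τ). -/
def theta3 (z τ : ℂ) : ℂ :=
  1 + 2 * ∑' n : ℕ, exp (piC * I * τ * ((n : ℂ) + 1) ^ 2) * cos (2 * ((n : ℂ) + 1) * z)

/-- Jacobi theta function θ₄(z|τ). -/
def theta4 (z τ : ℂ) : ℂ :=
  1 + 2 * ∑' n : ℕ, (-1 : ℂ) ^ (n + 1) * exp (piC * I * τ * ((n : ℂ) + 1) ^ 2) *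
    cos (2 * ((n : ℂ) + 1) * z)

/-- θ₁'(τ) = (∂θ₁/∂z)(0|τ). -/
def theta1' (τ : ℂ) : ℂ := deriv (fun z => theta1 z τ) 0

/-- The Dedekind eta function. -/
def eta (τ : ℂ) : ℂ := exp (piC * I * τ / 12) * ∏' n : ℕ, (1 - qq τ ^ (n + 1))

/-- Eisenstein series L = E₂. -/
def EisL (τ : ℂ) : ℂ :=
  1 - 24 * ∑' n : ℕ, ((n : ℂ) + 1) * qq τ ^ (n + 1) / (1 - qq τ ^ (n + 1))

/-- Eisenstein series M = E₄. -/
def EisM (τ : ℂ) : ℂ :=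
  1 + 240 * ∑' n : ℕ, ((n : ℂ) + 1) ^ 3 * qq τ ^ (n + 1) / (1 - qq τ ^ (n + 1))

/-- The period lattice Λ = {mπ + nπτ : m, n ∈ ℤ}. -/
def Lambda (τ : ℂ) : Set ℂ := {z | ∃ m n : ℤ, z = (m : ℂ) * piC + (n : ℂ) * piC * τ}

/-- The Weierstrass ℘ function attached to the lattice with periods π and πτ. -/
def wp (τ z : ℂ) : ℂ :=
  1 / z ^ 2 + ∑' p : ℤ × ℤ,
    if p = (0, 0) then 0
    else 1 / (z - ((p.1 : ℂ) * piC + (p.2 : ℂ) * piC * τ)) ^ 2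
      - 1 / ((p.1 : ℂ) * piC + (p.2 : ℂ) * piC * τ) ^ 2

open Filter Topology

/-! ### Extending functions across isolated singularities -/

/-- `G` agrees on a punctured neighbourhood of `p` with a function analytic at `p`. -/
def Extendable (G : ℂ → ℂ) (p : ℂ) : Prop :=
  ∃ h : ℂ → ℂ, AnalyticAt ℂ h p ∧ G =ᶠ[𝓝[≠] p] h

lemma Extendable.of_analyticAt {G : ℂ → ℂ} {p : ℂ} (h : AnalyticAt ℂ G p) : Extendable G p :=
  ⟨G, h, EventuallyEq.rfl⟩

lemma Extendable.congr {G H : ℂ → ℂ} {p : ℂ} (h : Extendable G p) (e : H =ᶠ[𝓝[≠] p] G) :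
    Extendable H p := by
  obtain ⟨k, hk, e'⟩ := h
  exact ⟨k, hk, e.trans e'⟩

lemma Extendable.add {G H : ℂ → ℂ} {p : ℂ} (hG : Extendable G p) (hH : Extendable H p) :
    Extendable (fun z => G z + H z) p := by
  obtain ⟨g, hg, eg⟩ := hG
  obtain ⟨h, hh, eh⟩ := hH
  exact ⟨fun z => g z + h z, hg.add hh, eg.add eh⟩

lemma Extendable.sub {G H : ℂ → ℂ} {p : ℂ} (hG : Extendable G p) (hH : Extendable H p) :
    Extendable (fun z => G z - H z) p := by
  obtain ⟨g, hg, eg⟩ := hG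
  obtain ⟨h, hh, eh⟩ := hH
  exact ⟨fun z => g z - h z, hg.sub hh, eg.sub eh⟩

lemma Extendable.const_mul {G : ℂ → ℂ} {p : ℂ} (c : ℂ) (hG : Extendable G p) :
    Extendable (fun z => c * G z) p := by
  obtain ⟨g, hg, eg⟩ := hG
  exact ⟨fun z => c * g z, analyticAt_const.mul hg, eg.mono fun z hz => by simp [hz]⟩

lemma Extendable.sum {ι : Type*} (s : Finset ι) {G : ι → ℂ → ℂ} {p : ℂ}
    (hG : ∀ i ∈ s, Extendable (G i) p) : Extendable (fun z => ∑ i ∈ s, G i z) p := by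
  classical
  induction s using Finset.induction_on with
  | empty => simpa using Extendable.of_analyticAt analyticAt_const
  | insert i s hi ih =>
    simp only [Finset.sum_insert hi]
    exact (hG i (by simp)).add (ih fun j hj => hG j (by simp [hj]))

lemma tendsto_sub_nhdsNE (p a : ℂ) : Tendsto (fun z => z - a) (𝓝[≠] p) (𝓝[≠] (p - a)) := by
  refine tendsto_nhdsWithin_of_tendsto_nhds_of_eventually_within _ ?_ ?_
  · exact ((continuous_id.sub continuous_const).tendsto p).mono_left nhdsWithin_le_nhds
  · filter_upwards [self_mem_nhdsWithin] with z hz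
    simpa [sub_left_inj] using hz

lemma Extendable.comp_sub {G : ℂ → ℂ} {p : ℂ} (a : ℂ) (hG : Extendable G (p - a)) :
    Extendable (fun z => G (z - a)) p := by
  obtain ⟨g, hg, eg⟩ := hG
  refine ⟨fun z => g (z - a), ?_, (tendsto_sub_nhdsNE p a).eventually eg⟩
  exact AnalyticAt.comp_of_eq hg (by fun_prop) rfl

/-- A function that extends analytically across every point agrees, off a discrete set, with an
entire function. -/
lemma exists_entire_of_extendable {G : ℂ → ℂ} (hG : ∀ p, Extendable G p) :
    ∃ E : ℂ → ℂ, Differentiable ℂ E ∧ ∀ p, G =ᶠ[𝓝[≠] p] E := by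
  choose h hh e using hG
  have key : ∀ p, (fun z => h z z) =ᶠ[𝓝 p] h p := by
    intro p
    have h1 : ∀ᶠ y in 𝓝[≠] p, G =ᶠ[𝓝 y] h p := eventually_nhdsNE_eventually_nhds_iff.2 (e p)
    have h2 : ∀ᶠ y in 𝓝[≠] p, ContinuousAt (h p) y :=
      ((hh p).eventually_analyticAt.filter_mono nhdsWithin_le_nhds).mono
        fun y hy => hy.continuousAt
    have h3 : ∀ᶠ y in 𝓝[≠] p, h y y = h p y := by
      filter_upwards [h1, h2] with y hy hc
      have e1 : h y =ᶠ[𝓝[≠] y] h p := (e y).symm.trans (hy.filter_mono nhdsWithin_le_nhds)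
      exact ((hh y).continuousAt.eventuallyEq_nhds_iff_eventuallyEq_nhdsNE hc).1 e1 |>.eq_of_nhds
    rw [eventually_nhdsWithin_iff] at h3
    filter_upwards [h3] with y hy
    by_cases hyp : y = p
    · rw [hyp]
    · exact hy hyp
  refine ⟨fun z => h z z, fun p => ?_, fun p => ?_⟩
  · exact ((hh p).congr (key p).symm).differentiableAt
  · exact (e p).trans ((key p).symm.filter_mono nhdsWithin_le_nhds)

/-! ### Liouville's theorem for doubly periodic functions -/

lemma piC_ne_zero : piC ≠ 0 := by simp [piC, Real.pi_ne_zero]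

lemma piC_im : piC.im = 0 := by simp [piC]

lemma piC_re : piC.re = Real.pi := by simp [piC]

lemma exists_lattice_decomposition {τ : ℂ} (hτ : 0 < τ.im) (z : ℂ) :
    ∃ s ∈ Set.Icc (0 : ℝ) 1, ∃ t ∈ Set.Icc (0 : ℝ) 1, ∃ m n : ℤ,
      z = (s : ℂ) * piC + t * (piC * τ) + m * piC + n * (piC * τ) := by
  have hpi := Real.pi_pos
  set b := z.im / (Real.pi * τ.im)
  set a := (z.re - b * (Real.pi * τ.re)) / Real.pi
  refine ⟨Int.fract a, ⟨Int.fract_nonneg a, (Int.fract_lt_one a).le⟩,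
    Int.fract b, ⟨Int.fract_nonneg b, (Int.fract_lt_one b).le⟩, ⌊a⌋, ⌊b⌋, ?_⟩
  have ha : ((Int.fract a : ℝ) : ℂ) + (⌊a⌋ : ℂ) = (a : ℂ) := by exact_mod_cast Int.fract_add_floor a
  have hb : ((Int.fract b : ℝ) : ℂ) + (⌊b⌋ : ℂ) = (b : ℂ) := by exact_mod_cast Int.fract_add_floor b
  have : z = (a : ℂ) * piC + b * (piC * τ) := by
    have hb' : b * (Real.pi * τ.im) = z.im := div_mul_cancel₀ _ (by positivity)
    have ha' : a * Real.pi = z.re - b * (Real.pi * τ.re) := div_mul_cancel₀ _ hpi.ne'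
    apply Complex.ext
    · simp [piC_re, piC_im]
      linarith
    · simp [piC_re, piC_im]
      linarith
  calc z = (a : ℂ) * piC + b * (piC * τ) := this
    _ = _ := by rw [← ha, ← hb]; ring

lemma eq_const_of_doubly_periodic {τ : ℂ} (hτ : 0 < τ.im) {E : ℂ → ℂ} (hE : Differentiable ℂ E)
    (h1 : ∀ z, E (z + piC) = E z) (h2 : ∀ z, E (z + piC * τ) = E z) : ∃ c, ∀ z, E z = c := by
  have p1 : Function.Periodic E piC := h1
  have p2 : Function.Periodic E (piC * τ) := h2
  apply hE.exists_const_forall_eq_of_bounded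
  let K : ℝ × ℝ → ℂ := fun x => (x.1 : ℂ) * piC + x.2 * (piC * τ)
  have hK : Continuous K := by fun_prop
  have hc : IsCompact (Set.Icc (0 : ℝ) 1 ×ˢ Set.Icc (0 : ℝ) 1) := isCompact_Icc.prod isCompact_Icc
  refine ((hc.image (hE.continuous.comp hK)).isBounded).subset ?_
  rintro _ ⟨z, rfl⟩
  obtain ⟨s, hs, t, ht, m, n, rfl⟩ := exists_lattice_decomposition hτ z
  refine ⟨(s, t), ⟨hs, ht⟩, ?_⟩
  rw [p2.int_mul n, p1.int_mul m]
  rfl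

lemma eq_zero_of_quasi_periodic {τ c : ℂ} (hτ : 0 < τ.im) {E : ℂ → ℂ} (hE : Differentiable ℂ E)
    (h1 : ∀ z, E (z + piC) = E z) (h2 : ∀ z, E (z + piC * τ) = E z + c) : c = 0 := by
  obtain ⟨a, ha⟩ : ∃ a, ∀ z, deriv E z = a := by
    refine eq_const_of_doubly_periodic hτ hE.deriv (fun z => ?_) (fun z => ?_)
    · rw [← deriv_comp_add_const]
      simp [h1]
    · rw [← deriv_comp_add_const]
      simp [h2]
  have hd : Differentiable ℂ (fun z => E z - a * z) := by fun_prop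
  have h0 : ∀ z, E z - a * z = E 0 := by
    intro z
    have := is_const_of_deriv_eq_zero hd (fun w => by
      rw [deriv_fun_sub (hE w) (by fun_prop), ha]; simp) z 0
    simpa using this
  have e1 := h0 piC
  have e1' := h1 0
  have e2 := h0 (piC * τ)
  have e2' := h2 0
  rw [zero_add] at e1' e2'
  have : a * piC = 0 := by linear_combination e1' - e1
  have ha0 : a = 0 := (mul_eq_zero.1 this).resolve_right piC_ne_zero
  rw [ha0] at e2
  linear_combination e2 - e2'

lemma eventuallyEq_shift {G E : ℂ → ℂ} {p a : ℂ} (h : G =ᶠ[𝓝[≠] (p + a)] E) :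
    (fun z => G (z + a)) =ᶠ[𝓝[≠] p] fun z => E (z + a) := by
  have := tendsto_sub_nhdsNE p (-a)
  simp only [sub_neg_eq_add] at this
  exact this.eventually h

lemma eq_of_eventuallyEq_nhdsNE {G E : ℂ → ℂ} (hG : Continuous G) (hE : Continuous E)
    (h : ∀ p, G =ᶠ[𝓝[≠] p] E) (z : ℂ) : G z = E z :=
  ((hG.continuousAt.eventuallyEq_nhds_iff_eventuallyEq_nhdsNE hE.continuousAt).1 (h z)).eq_of_nhds

lemma eq_zero_of_extendable_quasi_periodic {τ c : ℂ} (hτ : 0 < τ.im) {G : ℂ → ℂ}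
    (hG : ∀ p, Extendable G p)
    (h1 : ∀ p, ∀ᶠ z in 𝓝[≠] p, G (z + piC) = G z)
    (h2 : ∀ p, ∀ᶠ z in 𝓝[≠] p, G (z + piC * τ) = G z + c) : c = 0 := by
  obtain ⟨E, hE, e⟩ := exists_entire_of_extendable hG
  have hc := hE.continuous
  refine eq_zero_of_quasi_periodic hτ hE ?_ ?_
  · refine eq_of_eventuallyEq_nhdsNE (by fun_prop) hc fun p => ?_
    filter_upwards [e p, h1 p, eventuallyEq_shift (e (p + piC))] with z a b c
    rw [← c, b, a]
  · refine eq_of_eventuallyEq_nhdsNE (G := fun z => E (z + piC * τ)) (by fun_prop)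
      (by fun_prop) fun p => ?_
    filter_upwards [e p, h2 p, eventuallyEq_shift (e (p + piC * τ))] with z a b c
    rw [← c, b, a]

/-! ### Isolated zeros and simple poles -/

lemma exists_eq_add_sub_mul {F : ℂ → ℂ} {p : ℂ} (hF : AnalyticAt ℂ F p) :
    ∃ G : ℂ → ℂ, AnalyticAt ℂ G p ∧ (∀ z, F z = F p + (z - p) * G z) ∧ G p = deriv F p := by
  obtain ⟨P, hP⟩ := hF
  refine ⟨dslope F p, hP.has_fpower_series_dslope_fslope.analyticAt, fun z => ?_, dslope_same F p⟩
  have := sub_smul_dslope F p z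
  rw [smul_eq_mul] at this
  rw [this]
  ring

lemma extendable_div_sub_simple_pole {F D : ℂ → ℂ} {p : ℂ} (hF : AnalyticAt ℂ F p)
    (hD : AnalyticAt ℂ D p) (h0 : D p = 0) (h1 : deriv D p ≠ 0) :
    Extendable (fun z => F z / D z - F p / deriv D p * (z - p)⁻¹) p := by
  obtain ⟨d, hd, ed, dp⟩ := exists_eq_add_sub_mul hD
  have hdp : d p ≠ 0 := dp ▸ h1
  obtain ⟨v, hv, ev, -⟩ := exists_eq_add_sub_mul (hF.div hd hdp)
  refine ⟨v, hv, ?_⟩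
  filter_upwards [self_mem_nhdsWithin] with z hz
  have hz' : z - p ≠ 0 := sub_ne_zero.2 hz
  have e := ev z
  simp only [Pi.div_apply] at e
  rw [ed z, h0, zero_add, mul_comm, ← div_div, e, ← dp]
  field_simp
  ring

/-! ### Functions with the zeros and quasi-periods of `θ₁` -/

/-- An entire function with the quasi-periodicity of `θ₁`, whose zeros lie on the period lattice
and which has a simple zero at the origin. -/
structure IsSigma (τ : ℂ) (S : ℂ → ℂ) : Prop where
  differentiable : Differentiable ℂ S
  add_pi : ∀ z, S (z + piC) = -S z
  add_tau : ∀ z, S (z + piC * τ) = -exp (-(I * piC * τ)) * exp (-(2 * I * z)) * S z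
  mem_of_eq_zero : ∀ z, S z = 0 → z ∈ Lambda τ
  map_zero : S 0 = 0
  deriv_ne_zero : deriv S 0 ≠ 0

lemma eventually_ne_zero_of_entire {S : ℂ → ℂ} (hS : Differentiable ℂ S) (h0 : ∃ z, S z ≠ 0)
    (p : ℂ) : ∀ᶠ z in 𝓝[≠] p, S z ≠ 0 := by
  have ha : AnalyticOnNhd ℂ S Set.univ := fun z _ => hS.analyticAt z
  by_contra h
  obtain ⟨z, hz⟩ := h0
  refine hz (ha.eqOn_zero_of_preconnected_of_frequently_eq_zero isPreconnected_univ
    (Set.mem_univ p) ?_ (Set.mem_univ z))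
  rw [Filter.not_eventually] at h
  exact h.mono fun z hz => not_not.1 hz

namespace IsSigma

variable {τ : ℂ} {S : ℂ → ℂ}

lemma exists_ne_zero (hS : IsSigma τ S) : ∃ z, S z ≠ 0 := by
  by_contra! h
  apply hS.deriv_ne_zero
  rw [show S = fun _ => 0 from funext h]
  simp

lemma eventually_ne_zero (hS : IsSigma τ S) (p : ℂ) : ∀ᶠ z in 𝓝[≠] p, S z ≠ 0 :=
  eventually_ne_zero_of_entire hS.differentiable hS.exists_ne_zero p

lemma eq_zero_add_pi_iff (hS : IsSigma τ S) (z : ℂ) : S (z + piC) = 0 ↔ S z = 0 := by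
  rw [hS.add_pi, neg_eq_zero]

lemma eq_zero_add_tau_iff (hS : IsSigma τ S) (z : ℂ) : S (z + piC * τ) = 0 ↔ S z = 0 := by
  rw [hS.add_tau]
  simp [exp_ne_zero]

end IsSigma

/-- A predicate invariant under translation by `a` is invariant under integer multiples of `a`. -/
lemma iff_add_int_mul {P : ℂ → Prop} {a : ℂ} (h : ∀ z, P (z + a) ↔ P z) (n : ℤ) (z : ℂ) :
    P (z + n * a) ↔ P z := by
  have : Function.Periodic P a := fun z => propext (h z)
  exact iff_of_eq (this.int_mul n z)

lemma iff_of_mem_Lambda {τ : ℂ} {P : ℂ → Prop} (h1 : ∀ z, P (z + piC) ↔ P z)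
    (h2 : ∀ z, P (z + piC * τ) ↔ P z) {w : ℂ} (hw : w ∈ Lambda τ) (z : ℂ) : P (z + w) ↔ P z := by
  obtain ⟨m, n, rfl⟩ := hw
  rw [← add_assoc, mul_assoc, iff_add_int_mul h2, iff_add_int_mul h1]

lemma IsSigma.eq_zero_iff {τ : ℂ} {S : ℂ → ℂ} (hS : IsSigma τ S) (z : ℂ) :
    S z = 0 ↔ z ∈ Lambda τ := by
  refine ⟨hS.mem_of_eq_zero z, fun hz => ?_⟩
  have := iff_of_mem_Lambda (P := fun z => S z = 0) hS.eq_zero_add_pi_iff hS.eq_zero_add_tau_iff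
    hz 0
  rw [zero_add] at this
  exact this.2 hS.map_zero

lemma Lambda_sub {τ z w : ℂ} (hz : z ∈ Lambda τ) (hw : w ∈ Lambda τ) : z - w ∈ Lambda τ := by
  obtain ⟨m, n, rfl⟩ := hz
  obtain ⟨m', n', rfl⟩ := hw
  exact ⟨m - m', n - n', by push_cast; ring⟩

lemma Lambda_two_mul {τ z : ℂ} (hz : z ∈ Lambda τ) : 2 * z ∈ Lambda τ := by
  obtain ⟨m, n, rfl⟩ := hz
  exact ⟨2 * m, 2 * n, by push_cast; ring⟩

lemma even_of_half_mem_Lambda {τ : ℂ} (hτ : 0 < τ.im) {a b : ℤ}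
    (h : ((a : ℂ) * piC + b * (piC * τ)) / 2 ∈ Lambda τ) : Even a ∧ Even b := by
  obtain ⟨m, n, h⟩ := h
  have h' : (a : ℂ) * piC + b * (piC * τ) = 2 * (m * piC + n * piC * τ) := by
    rw [← h]; ring
  have hpi := Real.pi_pos
  have h2 : (a : ℂ) + b * τ = 2 * m + 2 * n * τ :=
    mul_left_cancel₀ piC_ne_zero (by linear_combination h')
  have him := congrArg Complex.im h2
  simp at him
  have hb : (b : ℝ) = 2 * n := by
    rcases him with h | h
    · exact h
    · exact absurd h hτ.ne'
  have hre := congrArg Complex.re h2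
  simp [hb] at hre
  have hre' : (a : ℝ) = 2 * m := by linarith
  have ha' : a = 2 * m := by exact_mod_cast hre'
  have hb' : b = 2 * n := by exact_mod_cast hb
  exact ⟨⟨m, by lia⟩, ⟨n, by lia⟩⟩

lemma Extendable.iff_add_of_eventually {G : ℂ → ℂ} {a c : ℂ}
    (h : ∀ p, ∀ᶠ z in 𝓝[≠] p, G (z + a) = G z + c) (p : ℂ) :
    Extendable G (p + a) ↔ Extendable G p := by
  constructor
  · intro hG
    have e : Extendable (fun z => G (z + a)) p := by
      simpa using Extendable.comp_sub (G := G) (p := p) (-a) (by simpa using hG)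
    refine (e.sub (.of_analyticAt (analyticAt_const (v := c)))).congr ?_
    filter_upwards [h p] with z hz
    rw [hz]; ring
  · intro hG
    have e : Extendable (fun z => G (z - a)) (p + a) := Extendable.comp_sub a (by simpa using hG)
    refine (e.add (.of_analyticAt (analyticAt_const (v := c)))).congr ?_
    have := (tendsto_sub_nhdsNE (p + a) a).eventually (by rw [add_sub_cancel_right]; exact h p)
    filter_upwards [this] with z hz
    rw [← hz]; simp

lemma eq_zero_of_extendable_representatives {τ c : ℂ} (hτ : 0 < τ.im) {G : ℂ → ℂ}
    (hG : ∀ p, ∃ p₀, p - p₀ ∈ Lambda τ ∧ Extendable G p₀)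
    (h1 : ∀ p, ∀ᶠ z in 𝓝[≠] p, G (z + piC) = G z)
    (h2 : ∀ p, ∀ᶠ z in 𝓝[≠] p, G (z + piC * τ) = G z + c) : c = 0 := by
  refine eq_zero_of_extendable_quasi_periodic hτ (fun p => ?_) h1 h2
  obtain ⟨p₀, hp, he⟩ := hG p
  have := iff_of_mem_Lambda (P := Extendable G)
    (Extendable.iff_add_of_eventually (c := 0) (by simpa using h1))
    (Extendable.iff_add_of_eventually h2) hp p₀
  rw [add_sub_cancel] at this
  exact this.2 he

/-! ### The logarithmic derivative -/

namespace IsSigma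

variable {τ : ℂ} {S : ℂ → ℂ}

lemma deriv_add_pi (hS : IsSigma τ S) (z : ℂ) : deriv S (z + piC) = -deriv S z := by
  rw [← deriv_comp_add_const, ← deriv.fun_neg]
  simp [hS.add_pi]

lemma deriv_add_tau (hS : IsSigma τ S) (z : ℂ) : deriv S (z + piC * τ) =
    -exp (-(I * piC * τ)) * exp (-(2 * I * z)) * (deriv S z - 2 * I * S z) := by
  rw [← deriv_comp_add_const]
  simp only [hS.add_tau]
  have h := hS.differentiable z
  have he : HasDerivAt (fun z : ℂ => exp (-(2 * I * z))) (exp (-(2 * I * z)) * (-(2 * I * 1))) z :=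
    (((hasDerivAt_id z).const_mul (2 * I)).neg).cexp
  have := ((he.const_mul (-exp (-(I * piC * τ)))).mul h.hasDerivAt).deriv
  rw [show (fun z => -cexp (-(I * piC * τ)) * cexp (-(2 * I * z)) * S z) =
    ((fun z => -cexp (-(I * piC * τ)) * cexp (-(2 * I * z))) * S) from rfl, this]
  ring

lemma logDeriv_add_pi (hS : IsSigma τ S) (z : ℂ) : logDeriv S (z + piC) = logDeriv S z := by
  rw [logDeriv_apply, logDeriv_apply, hS.deriv_add_pi, hS.add_pi, neg_div_neg_eq]

lemma logDeriv_add_tau (hS : IsSigma τ S) {z : ℂ} (hz : S z ≠ 0) :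
    logDeriv S (z + piC * τ) = logDeriv S z - 2 * I := by
  rw [logDeriv_apply, logDeriv_apply, hS.deriv_add_tau, hS.add_tau]
  have h1 := exp_ne_zero (-(I * piC * τ))
  have h2 := exp_ne_zero (-(2 * I * z))
  field_simp

lemma iteratedDeriv_logDeriv_add_pi (hS : IsSigma τ S) (k : ℕ) (z : ℂ) :
    iteratedDeriv k (logDeriv S) (z + piC) = iteratedDeriv k (logDeriv S) z := by
  have := congrFun (iteratedDeriv_comp_add_const k (logDeriv S) piC) z
  rw [← this]
  simp [hS.logDeriv_add_pi]

lemma iteratedDeriv_logDeriv_add_tau (hS : IsSigma τ S) (k : ℕ) (p : ℂ) :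
    ∀ᶠ z in 𝓝[≠] p, iteratedDeriv k (logDeriv S) (z + piC * τ) =
      iteratedDeriv k (logDeriv S) z + if k = 0 then -2 * I else 0 := by
  have h0 : ∀ᶠ z in 𝓝[≠] p, logDeriv S (z + piC * τ) = logDeriv S z - 2 * I := by
    filter_upwards [hS.eventually_ne_zero p] with z hz using hS.logDeriv_add_tau hz
  induction k with
  | zero =>
    filter_upwards [h0] with z hz
    simp only [iteratedDeriv_zero, hz, if_true]
    ring
  | succ k ih =>
    filter_upwards [EventuallyEq.nhdsNE_deriv ih] with z hz
    rw [deriv_comp_add_const] at hz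
    simpa [iteratedDeriv_succ] using hz

lemma analyticAt_iteratedDeriv_logDeriv (hS : IsSigma τ S) (k : ℕ) {p : ℂ} (hp : p ∉ Lambda τ) :
    AnalyticAt ℂ (iteratedDeriv k (logDeriv S)) p := by
  have h := hS.differentiable.analyticAt p
  have : AnalyticAt ℂ (logDeriv S) p := h.deriv.div h (mt (hS.eq_zero_iff p).1 hp)
  rw [iteratedDeriv_eq_iterate]
  exact this.iterated_deriv k

lemma extendable_logDeriv_sub (hS : IsSigma τ S) (k : ℕ) :
    Extendable (fun z => iteratedDeriv k (logDeriv S) z -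
      (-1) ^ k * k.factorial * z ^ (-1 - k : ℤ)) 0 := by
  obtain ⟨s, hs, es, s0⟩ := exists_eq_add_sub_mul (hS.differentiable.analyticAt 0)
  have hs0 : s 0 ≠ 0 := s0 ▸ hS.deriv_ne_zero
  have hl : AnalyticAt ℂ (logDeriv s) 0 := hs.deriv.div hs hs0
  have e0 : logDeriv S =ᶠ[𝓝[≠] 0] fun z => z⁻¹ + logDeriv s z := by
    have hn : ∀ᶠ z in 𝓝[≠] (0 : ℂ), s z ≠ 0 :=
      (hs.continuousAt.eventually_ne hs0).filter_mono nhdsWithin_le_nhds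
    have hd : ∀ᶠ z in 𝓝[≠] (0 : ℂ), DifferentiableAt ℂ s z :=
      (hs.eventually_analyticAt.filter_mono nhdsWithin_le_nhds).mono
        fun z hz => hz.differentiableAt
    have eS : S = fun z => id z * s z := by
      funext z
      rw [es z, hS.map_zero]
      simp
    filter_upwards [hn, hd, self_mem_nhdsWithin] with z h1 h2 h3
    rw [eS, logDeriv_mul (f := id) z (by simpa using h3) h1 differentiableAt_id h2,
      logDeriv_id, one_div]
  suffices ∃ h, AnalyticAt ℂ h 0 ∧ iteratedDeriv k (logDeriv S) =ᶠ[𝓝[≠] 0]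
      fun z => (-1) ^ k * k.factorial * z ^ (-1 - k : ℤ) + h z by
    obtain ⟨h, hh, e⟩ := this
    refine ⟨h, hh, ?_⟩
    filter_upwards [e] with z hz
    rw [hz]; ring
  refine ⟨iteratedDeriv k (logDeriv s), by
    rw [iteratedDeriv_eq_iterate]; exact hl.iterated_deriv k, ?_⟩
  have e1 : iteratedDeriv k (logDeriv S) =ᶠ[𝓝[≠] 0]
      iteratedDeriv k (fun z => z⁻¹ + logDeriv s z) := by
    have := eventually_nhdsNE_eventually_nhds_iff.2 e0
    filter_upwards [this] with z hz using EventuallyEq.iteratedDeriv_eq k hz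
  have hla : ∀ᶠ z in 𝓝[≠] (0 : ℂ), AnalyticAt ℂ (logDeriv s) z :=
    hl.eventually_analyticAt.filter_mono nhdsWithin_le_nhds
  filter_upwards [e1, hla, self_mem_nhdsWithin] with z h1 h2 h3
  have hi : AnalyticAt ℂ (fun z : ℂ => z⁻¹) z := analyticAt_inv h3
  rw [h1, iteratedDeriv_fun_add hi.contDiffAt h2.contDiffAt]
  congr 1
  rw [iteratedDeriv_eq_iterate]
  exact iter_deriv_inv k z

end IsSigma

/-! ### The residue identity -/

/-- The coefficients of `π` in twice the nonzero half periods. -/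
def halfA : Fin 3 → ℤ := ![1, 1, 0]

/-- The coefficients of `πτ` in twice the nonzero half periods. -/
def halfB : Fin 3 → ℤ := ![0, 1, 1]

/-- The nonzero half periods `π/2`, `(π+πτ)/2`, `πτ/2`. -/
def halfPeriod (τ : ℂ) (i : Fin 3) : ℂ := ((halfA i : ℂ) * piC + halfB i * (piC * τ)) / 2

lemma halfPeriod_not_mem {τ : ℂ} (hτ : 0 < τ.im) (i : Fin 3) : halfPeriod τ i ∉ Lambda τ := by
  intro h
  have := even_of_half_mem_Lambda hτ h
  revert this
  fin_cases i <;> decide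

lemma halfPeriod_sub_not_mem {τ : ℂ} (hτ : 0 < τ.im) {i j : Fin 3} (hij : i ≠ j) :
    halfPeriod τ i - halfPeriod τ j ∉ Lambda τ := by
  intro h
  have e : halfPeriod τ i - halfPeriod τ j =
      (((halfA i - halfA j : ℤ) : ℂ) * piC + ((halfB i - halfB j : ℤ) : ℂ) * (piC * τ)) / 2 := by
    simp only [halfPeriod]; push_cast; ring
  rw [e] at h
  have := even_of_half_mem_Lambda hτ h
  revert this hij
  fin_cases i <;> fin_cases j <;> decide

lemma two_mul_halfPeriod_mem (τ : ℂ) (i : Fin 3) : 2 * halfPeriod τ i ∈ Lambda τ :=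
  ⟨halfA i, halfB i, by simp only [halfPeriod]; ring⟩

lemma exists_halfPeriod_of_two_mul_mem {τ p : ℂ} (h : 2 * p ∈ Lambda τ) :
    p ∈ Lambda τ ∨ ∃ i, p - halfPeriod τ i ∈ Lambda τ := by
  obtain ⟨m, n, h⟩ := h
  rcases Int.even_or_odd' m with ⟨m, rfl | rfl⟩ <;> rcases Int.even_or_odd' n with ⟨n, rfl | rfl⟩
  · exact .inl ⟨m, n, by push_cast at h; linear_combination h / 2⟩
  · refine .inr ⟨2, m, n, ?_⟩
    simp [halfPeriod, halfA, halfB]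
    push_cast at h; linear_combination h / 2
  · refine .inr ⟨0, m, n, ?_⟩
    simp [halfPeriod, halfA, halfB]
    push_cast at h; linear_combination h / 2
  · refine .inr ⟨1, m, n, ?_⟩
    simp [halfPeriod, halfA, halfB]
    push_cast at h; linear_combination h / 2

namespace IsSigma

variable {τ : ℂ} {S : ℂ → ℂ}

lemma deriv_ne_zero_of_mem (hS : IsSigma τ S) {z : ℂ} (hz : z ∈ Lambda τ) : deriv S z ≠ 0 := by
  have := iff_of_mem_Lambda (τ := τ) (P := fun z => S z = 0 ∧ deriv S z ≠ 0) (fun z => by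
    rw [hS.eq_zero_add_pi_iff, hS.deriv_add_pi, neg_ne_zero]) (fun z => by
    rw [hS.eq_zero_add_tau_iff, hS.deriv_add_tau]
    refine and_congr_right fun h => ?_
    simp [h, exp_ne_zero]) hz 0
  rw [zero_add] at this
  exact (this.2 ⟨hS.map_zero, hS.deriv_ne_zero⟩).2

lemma deriv_denominator (hS : IsSigma τ S) {z : ℂ} (hz : 2 * z ∈ Lambda τ) :
    deriv (fun z => S (2 * z) * S z ^ 4) z = 2 * deriv S (2 * z) * S z ^ 4 := by
  have h1 : HasDerivAt (fun z => S (2 * z)) (deriv S (2 * z) * (2 * 1)) z :=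
    (hS.differentiable (2 * z)).hasDerivAt.comp z ((hasDerivAt_id z).const_mul 2)
  have h2 := (hS.differentiable z).hasDerivAt.pow 4
  have := (h1.mul h2).deriv
  rw [(hS.eq_zero_iff _).2 hz] at this
  rw [show (fun z => S (2 * z) * S z ^ 4) = (fun z => S (2 * z)) * S ^ 4 from rfl, this]
  simp only [Pi.pow_apply]
  ring

lemma denominator_add_pi (hS : IsSigma τ S) (z : ℂ) :
    S (2 * (z + piC)) * S (z + piC) ^ 4 = S (2 * z) * S z ^ 4 := by
  rw [show 2 * (z + piC) = 2 * z + piC + piC by ring, hS.add_pi, hS.add_pi, hS.add_pi]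
  ring

lemma denominator_add_tau (hS : IsSigma τ S) (z : ℂ) :
    qq τ ^ 4 * exp (16 * I * z) * (S (2 * (z + piC * τ)) * S (z + piC * τ) ^ 4) =
      S (2 * z) * S z ^ 4 := by
  rw [show 2 * (z + piC * τ) = 2 * z + piC * τ + piC * τ by ring, hS.add_tau, hS.add_tau,
    hS.add_tau]
  have e : qq τ ^ 4 * exp (16 * I * z) * (exp (-(I * piC * τ)) *
      exp (-(2 * I * (2 * z + piC * τ))) * exp (-(I * piC * τ)) * exp (-(2 * I * (2 * z))) *
      (exp (-(I * piC * τ)) * exp (-(2 * I * z))) ^ 4) = 1 := by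
    simp only [qq, ← exp_add, ← exp_nat_mul]
    rw [exp_eq_one_iff]
    exact ⟨0, by push_cast; ring⟩
  linear_combination (S (2 * z) * S z ^ 4) * e

/-- The residues of `f(z) / (S(2z) S(z)⁴)` at the half periods sum to zero. -/
theorem sum_residues (hS : IsSigma τ S) (hτ : 0 < τ.im) {f : ℂ → ℂ} (hf : Differentiable ℂ f)
    (hper1 : ∀ z : ℂ, f z = f (z + piC))
    (hper2 : ∀ z : ℂ, f z = qq τ ^ 4 * exp (16 * I * z) * f (z + piC * τ))
    {u : ℂ → ℂ} (hu : AnalyticAt ℂ u 0)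
    (hfu : ∀ᶠ z in 𝓝[≠] 0, f z / (S (2 * z) * S z ^ 4) = u z / z ^ 5) :
    iteratedDeriv 4 u 0 / 24 + ∑ i, f (halfPeriod τ i) /
      (2 * deriv S (2 * halfPeriod τ i) * S (halfPeriod τ i) ^ 4) = 0 := by
  let D : ℂ → ℂ := fun z => S (2 * z) * S z ^ 4
  have hdS := hS.differentiable
  have hD : Differentiable ℂ D := by fun_prop
  let a : ℕ → ℂ := fun k =>
    iteratedDeriv (4 - k) u 0 / (4 - k).factorial * ((-1) ^ k / k.factorial)
  let r : Fin 3 → ℂ := fun i => f (halfPeriod τ i) / deriv D (halfPeriod τ i)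
  let Z : ℂ → ℂ := logDeriv S
  let G : ℂ → ℂ := fun z => f z / D z - ∑ k ∈ Finset.range 5, a k * iteratedDeriv k Z z -
    ∑ i, r i * Z (z - halfPeriod τ i)
  have hZan : ∀ {p : ℂ}, p ∉ Lambda τ → AnalyticAt ℂ Z p := fun hp => by
    simpa using hS.analyticAt_iteratedDeriv_logDeriv 0 hp
  have hZshift : ∀ {p : ℂ} (i : Fin 3), p - halfPeriod τ i ∉ Lambda τ →
      Extendable (fun z => Z (z - halfPeriod τ i)) p := fun i hp =>
    Extendable.comp_sub _ (.of_analyticAt (hZan hp))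
  have hdD : ∀ i, deriv D (halfPeriod τ i) ≠ 0 := fun i => by
    rw [hS.deriv_denominator (two_mul_halfPeriod_mem τ i)]
    have h1 := hS.deriv_ne_zero_of_mem (two_mul_halfPeriod_mem τ i)
    have h2 := mt (hS.eq_zero_iff _).1 (halfPeriod_not_mem hτ i)
    exact mul_ne_zero (mul_ne_zero two_ne_zero h1) (pow_ne_zero _ h2)
  have hc : 2 * I * (a 0 + ∑ i, r i) = 0 := by
    refine eq_zero_of_extendable_representatives hτ (G := G) (fun p => ?_) (fun p => ?_)
      (fun p => ?_)
    · by_cases hp : 2 * p ∈ Lambda τ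
      · rcases exists_halfPeriod_of_two_mul_mem hp with h | ⟨i, h⟩
        · refine ⟨0, by simpa using h, ?_⟩
          obtain ⟨F, hF, eF⟩ := hu.exists_eq_sum_add_pow_mul 5
          have e1 := ((Extendable.of_analyticAt hF).sub (.sum (Finset.range 5) fun k _ =>
            (hS.extendable_logDeriv_sub k).const_mul (a k))).sub
            (.sum Finset.univ fun i _ => (hZshift (p := 0) i (fun h => halfPeriod_not_mem hτ i (by
              simpa using Lambda_sub (z := 0) ⟨0, 0, by simp⟩ h))).const_mul (r i))
          refine e1.congr ?_
          filter_upwards [hfu, self_mem_nhdsWithin] with z hz hz0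
          have hz0 : z ≠ 0 := hz0
          simp only [G]
          congr 1
          rw [show f z / D z = u z / z ^ 5 from hz, eF z]
          simp only [Finset.sum_range_succ, Finset.sum_range_zero, a, smul_eq_mul]
          have hp : ∀ k : ℕ, z ^ (-1 - (k : ℤ)) = (z ^ (k + 1))⁻¹ := fun k => by
            rw [← zpow_natCast, ← zpow_neg]
            congr 1
            push_cast
            ring
          simp only [hp, Nat.factorial]
          norm_num
          field_simp
          ring
        · refine ⟨halfPeriod τ i, h, ?_⟩
          have hi := halfPeriod_not_mem hτ i
          have e1 := extendable_div_sub_simple_pole (hf.analyticAt (halfPeriod τ i))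
            (hD.analyticAt (halfPeriod τ i))
            (by simp [D, (hS.eq_zero_iff _).2 (two_mul_halfPeriod_mem τ i)]) (hdD i)
          have e2 : Extendable (fun z => ∑ k ∈ Finset.range 5, a k * iteratedDeriv k Z z)
              (halfPeriod τ i) := .sum _ fun k _ =>
            (Extendable.of_analyticAt (hS.analyticAt_iteratedDeriv_logDeriv k hi)).const_mul _
          have e3 : Extendable (fun z => ∑ j, r j * (Z (z - halfPeriod τ j) -
              if j = i then (z - halfPeriod τ i)⁻¹ else 0)) (halfPeriod τ i) := by
            refine .sum _ fun j _ => Extendable.const_mul _ ?_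
            by_cases hj : j = i
            · subst hj
              simp only [if_true]
              have := hS.extendable_logDeriv_sub 0
              exact Extendable.comp_sub (G := fun z => Z z - z⁻¹) _ (by simpa using this)
            · simp only [hj, if_false, sub_zero]
              exact hZshift j (halfPeriod_sub_not_mem hτ (Ne.symm hj))
          refine ((e1.sub e2).sub e3).congr (.of_forall fun z => ?_)
          simp only [G, mul_sub, Finset.sum_sub_distrib, mul_ite, mul_zero, Finset.sum_ite_eq',
            Finset.mem_univ, if_true, r]
          ring
      · have hp' : p ∉ Lambda τ := fun h => hp (Lambda_two_mul h)
        have hpi : ∀ i, p - halfPeriod τ i ∉ Lambda τ := fun i h => hp (by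
          have := Lambda_two_mul h
          rw [mul_sub] at this
          obtain ⟨m, n, e⟩ := this
          obtain ⟨m', n', e'⟩ := two_mul_halfPeriod_mem τ i
          exact ⟨m + m', n + n', by push_cast; linear_combination e + e'⟩)
        refine ⟨p, ⟨0, 0, by simp⟩, ?_⟩
        have hDp : D p ≠ 0 := mul_ne_zero (mt (hS.eq_zero_iff _).1 hp)
          (pow_ne_zero _ (mt (hS.eq_zero_iff _).1 hp'))
        exact ((Extendable.of_analyticAt ((hf.analyticAt p).div (hD.analyticAt p) hDp)).sub
          (.sum _ fun k _ => (Extendable.of_analyticAt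
            (hS.analyticAt_iteratedDeriv_logDeriv k hp')).const_mul _)).sub
          (.sum _ fun i _ => (hZshift i (hpi i)).const_mul _)
    · refine .of_forall fun z => ?_
      simp only [G, D, Z, hS.denominator_add_pi, ← hper1, hS.iteratedDeriv_logDeriv_add_pi,
        add_sub_right_comm z piC, hS.logDeriv_add_pi]
    · have hk : ∀ᶠ z in 𝓝[≠] p, ∀ k ∈ Finset.range 5, iteratedDeriv k Z (z + piC * τ) =
          iteratedDeriv k Z z + if k = 0 then -2 * I else 0 :=
        (Filter.eventually_all_finset _).2 fun k _ => hS.iteratedDeriv_logDeriv_add_tau k p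
      have hi : ∀ᶠ z in 𝓝[≠] p, ∀ i, Z (z - halfPeriod τ i + piC * τ) =
          Z (z - halfPeriod τ i) - 2 * I :=
        Filter.eventually_all.2 fun i => by
          filter_upwards [(tendsto_sub_nhdsNE p (halfPeriod τ i)).eventually
            (hS.eventually_ne_zero _)] with z hz using hS.logDeriv_add_tau hz
      filter_upwards [hk, hi] with z hk hi
      have hH : f (z + piC * τ) / D (z + piC * τ) = f z / D z := by
        have hne : qq τ ^ 4 * exp (16 * I * z) ≠ 0 :=
          mul_ne_zero (pow_ne_zero _ (exp_ne_zero _)) (exp_ne_zero _)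
        rw [hper2 z, show D z = _ from (hS.denominator_add_tau z).symm, mul_div_mul_left _ _ hne]
      have hsk : ∑ k ∈ Finset.range 5, a k * iteratedDeriv k Z (z + piC * τ) =
          ∑ k ∈ Finset.range 5, a k * iteratedDeriv k Z z - 2 * I * a 0 := by
        rw [Finset.sum_congr rfl fun k hk' => congrArg (a k * ·) (hk k hk')]
        simp only [mul_add, Finset.sum_add_distrib, mul_ite, mul_zero, Finset.sum_ite_eq',
          Finset.mem_range]
        norm_num
        ring
      have hsi : ∑ i, r i * Z (z - halfPeriod τ i + piC * τ) =
          ∑ i, r i * Z (z - halfPeriod τ i) - 2 * I * ∑ i, r i := by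
        simp only [hi, mul_sub, Finset.sum_sub_distrib, ← Finset.sum_mul]
        ring
      simp only [G, hH, add_sub_right_comm z (piC * τ), hsk, hsi]
      ring
  have hc' : a 0 + ∑ i, r i = 0 := (mul_eq_zero.1 hc).resolve_left (by simp)
  have ha0 : a 0 = iteratedDeriv 4 u 0 / 24 := by simp [a, Nat.factorial]
  rw [← ha0, ← hc']
  congr 1
  refine Finset.sum_congr rfl fun i _ => ?_
  rw [← hS.deriv_denominator (two_mul_halfPeriod_mem τ i)]

end IsSigma

/-! ### The sigma product -/

/-- The infinite product `∏ (1 - q ^ n * w)`. -/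
def qProd (q w : ℂ) : ℂ := ∏' n : ℕ, (1 - q ^ n * w)

section qProd

variable {q : ℂ}

lemma summable_norm_pow_mul (hq : ‖q‖ < 1) (w : ℂ) : Summable fun n : ℕ => ‖q ^ n * w‖ := by
  simpa using (summable_geometric_of_lt_one (norm_nonneg _) hq).mul_right ‖w‖

lemma multipliable_one_sub_pow_mul (hq : ‖q‖ < 1) (w : ℂ) :
    Multipliable fun n : ℕ => 1 - q ^ n * w := by
  simpa [sub_eq_add_neg] using multipliable_one_add_of_summable (f := fun n : ℕ => -(q ^ n * w))
    (by simpa using! summable_norm_pow_mul hq w)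

lemma qProd_eq_mul (hq : ‖q‖ < 1) (w : ℂ) : qProd q w = (1 - w) * qProd q (q * w) := by
  have e : ∀ n : ℕ, 1 - q ^ (n + 1) * w = 1 - q ^ n * (q * w) := fun n => by ring
  rw [qProd, tprod_eq_zero_mul' (by simpa only [e] using multipliable_one_sub_pow_mul hq (q * w))]
  simp only [e, qProd, pow_zero, one_mul]

lemma exists_eq_one_of_qProd_eq_zero (hq : ‖q‖ < 1) {w : ℂ} (h : qProd q w = 0) :
    ∃ n : ℕ, q ^ n * w = 1 := by
  by_contra! hne
  refine tprod_one_add_ne_zero_of_summable (f := fun n : ℕ => -(q ^ n * w)) (fun n => ?_)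
    (by simpa using! summable_norm_pow_mul hq w) (by simpa [qProd, sub_eq_add_neg] using h)
  rw [← sub_eq_add_neg, sub_ne_zero]
  exact (hne n).symm

lemma differentiable_qProd (hq : ‖q‖ < 1) : Differentiable ℂ (qProd q) := by
  intro w
  have hK : IsOpen (Metric.ball (0 : ℂ) (‖w‖ + 1)) := Metric.isOpen_ball
  have h := Summable.hasProdLocallyUniformlyOn_nat_one_add (f := fun (n : ℕ) w => -(q ^ n * w)) hK
    ((summable_geometric_of_lt_one (norm_nonneg _) hq).mul_right (‖w‖ + 1))
    (.of_forall fun n x hx => by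
      rw [norm_neg, norm_mul, norm_pow]
      exact mul_le_mul_of_nonneg_left (mem_ball_zero_iff.1 hx).le (by positivity))
    (fun n => by fun_prop)
  have hd := (h.differentiableOn (.of_forall fun s => by
    simpa [Finset.prod_fn] using! DifferentiableOn.finsetProd (fun _ _ => by fun_prop)) hK)
    |>.differentiableAt (hK.mem_nhds (x := w) (by simp))
  simpa [qProd, sub_eq_add_neg, Function.comp_def] using! hd

end qProd

lemma norm_qq_lt_one {τ : ℂ} (hτ : 0 < τ.im) : ‖qq τ‖ < 1 := by
  have h := UpperHalfPlane.norm_exp_two_pi_I_lt_one ⟨τ, hτ⟩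
  simp only [qq, piC]
  convert h using 3

/-- The regular part `∏ (1 - qⁿ e^{2iz}) (1 - qⁿ e^{-2iz})`, `n ≥ 1`, of the sigma product. -/
def regularProd (τ z : ℂ) : ℂ :=
  qProd (qq τ) (qq τ * exp (2 * I * z)) * qProd (qq τ) (qq τ * exp (-(2 * I * z)))

/-- The product `-2i sin z ∏ (1 - qⁿ e^{2iz}) (1 - qⁿ e^{-2iz})`. -/
def sigmaProd (τ z : ℂ) : ℂ :=
  exp (-(I * z)) * qProd (qq τ) (exp (2 * I * z)) * qProd (qq τ) (qq τ * exp (-(2 * I * z)))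

lemma sigmaProd_eq {τ : ℂ} (hτ : 0 < τ.im) (z : ℂ) :
    sigmaProd τ z = -2 * I * (sin z * regularProd τ z) := by
  have hsin : exp (-(I * z)) * (1 - exp (2 * I * z)) = -2 * I * sin z := by
    rw [mul_sub, ← exp_add, sin, show -(I * z) + 2 * I * z = z * I by ring,
      show -(I * z) = -z * I by ring]
    linear_combination (exp (-z * I) - exp (z * I)) * I_sq
  rw [sigmaProd, qProd_eq_mul (norm_qq_lt_one hτ) (exp (2 * I * z)), regularProd]
  linear_combination (qProd (qq τ) (qq τ * exp (2 * I * z)) *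
    qProd (qq τ) (qq τ * exp (-(2 * I * z)))) * hsin

lemma differentiable_regularProd {τ : ℂ} (hτ : 0 < τ.im) : Differentiable ℂ (regularProd τ) := by
  have h := differentiable_qProd (norm_qq_lt_one hτ)
  exact (h.comp (by fun_prop : Differentiable ℂ fun z => qq τ * exp (2 * I * z))).mul
    (h.comp (by fun_prop : Differentiable ℂ fun z => qq τ * exp (-(2 * I * z))))

lemma mem_Lambda_of_exp_eq_one {τ z : ℂ} {n : ℤ}
    (h : exp (n * (2 * piC * I * τ) + 2 * I * z) = 1) : z ∈ Lambda τ := by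
  obtain ⟨k, hk⟩ := exp_eq_one_iff.1 h
  refine ⟨k, -n, mul_left_cancel₀ (mul_ne_zero two_ne_zero I_ne_zero) ?_⟩
  rw [piC] at *
  push_cast
  linear_combination hk

lemma isSigma_sigmaProd {τ : ℂ} (hτ : 0 < τ.im) : IsSigma τ (sigmaProd τ) := by
  have hq := norm_qq_lt_one hτ
  have hder : HasDerivAt (sigmaProd τ) (-2 * I * regularProd τ 0) 0 := by
    have h1 := (((hasDerivAt_sin 0).mul
      (differentiable_regularProd hτ 0).hasDerivAt).const_mul (-2 * I))
    simp only [sin_zero, cos_zero, zero_mul, add_zero, one_mul] at h1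
    exact h1.congr_of_eventuallyEq (.of_forall fun z => by simpa using sigmaProd_eq hτ z)
  refine ⟨?_, fun z => ?_, fun z => ?_, fun z hz => ?_, ?_, ?_⟩
  · rw [funext (sigmaProd_eq hτ)]
    exact (differentiable_sin.mul (differentiable_regularProd hτ)).const_mul _
  · have h1 : exp (-(I * (z + piC))) = -exp (-(I * z)) := by
      rw [show -(I * (z + piC)) = -(I * z) - Real.pi * I by simp only [piC]; ring, exp_sub,
        exp_pi_mul_I]
      ring
    have h2 : exp (2 * I * (z + piC)) = exp (2 * I * z) := by
      rw [show 2 * I * (z + piC) = 2 * I * z + 2 * Real.pi * I by simp only [piC]; ring, exp_add,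
        exp_two_pi_mul_I, mul_one]
    simp only [sigmaProd, exp_neg (2 * I * _), h1, h2]
    ring
  · have h1 : exp (-(I * (z + piC * τ))) = exp (-(I * piC * τ)) * exp (-(I * z)) := by
      rw [← exp_add]; ring_nf
    have h2 : exp (2 * I * (z + piC * τ)) = qq τ * exp (2 * I * z) := by
      rw [qq, ← exp_add]; ring_nf
    have h3 : qq τ * exp (-(2 * I * (z + piC * τ))) = exp (-(2 * I * z)) := by
      rw [qq, ← exp_add]; ring_nf
    have h4 : exp (-(2 * I * z)) * exp (2 * I * z) = 1 := by rw [← exp_add]; simp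
    rw [sigmaProd, h1, h2, h3, qProd_eq_mul hq (exp (-(2 * I * z))), sigmaProd,
      qProd_eq_mul hq (exp (2 * I * z))]
    linear_combination (-exp (-(I * piC * τ)) * exp (-(I * z)) *
      qProd (qq τ) (qq τ * exp (2 * I * z)) * qProd (qq τ) (qq τ * exp (-(2 * I * z)))) * h4
  · rw [sigmaProd, mul_eq_zero, mul_eq_zero, or_iff_right (exp_ne_zero _)] at hz
    rcases hz with h | h
    · obtain ⟨n, hn⟩ := exists_eq_one_of_qProd_eq_zero hq h
      rw [qq, ← exp_nat_mul, ← exp_add] at hn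
      exact mem_Lambda_of_exp_eq_one (n := n) (by simpa using hn)
    · obtain ⟨n, hn⟩ := exists_eq_one_of_qProd_eq_zero hq h
      rw [qq, ← exp_nat_mul, ← exp_add, ← exp_add] at hn
      refine mem_Lambda_of_exp_eq_one (n := -(n + 1)) ?_
      rw [← inv_inj, inv_one, ← hn, ← exp_neg]
      congr 1
      push_cast
      ring
  · simp [sigmaProd_eq hτ]
  · rw [hder.deriv]
    have h1 : qProd (qq τ) (qq τ) ≠ 0 := fun h => by
      obtain ⟨n, hn⟩ := exists_eq_one_of_qProd_eq_zero hq h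
      rw [← pow_succ] at hn
      have := congrArg norm hn
      rw [norm_pow, norm_one] at this
      exact (pow_lt_one₀ (norm_nonneg _) hq n.succ_ne_zero).ne this
    simp [regularProd, h1]

/-! ### The product formula for `θ₁` -/

lemma jacobiTheta₂_ne_zero {τ : ℂ} (hτ : 0 < τ.im) : ∃ z, jacobiTheta₂ z τ ≠ 0 := by
  by_contra! h0
  have hb := summable_pow_mul_jacobiTheta₂_term_bound 0 hτ 0
  simp only [pow_zero, one_mul] at hb
  have h := intervalIntegral.hasSum_integral_of_dominated_convergence (a := 0) (b := 1)
    (μ := MeasureTheory.volume) (F := fun (n : ℤ) (t : ℝ) => jacobiTheta₂_term n t τ)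
    (f := fun t : ℝ => jacobiTheta₂ t τ) _
    (fun n => by
      simp only [jacobiTheta₂_term]
      exact Continuous.aestronglyMeasurable (by fun_prop))
    (fun n => .of_forall fun t _ => norm_jacobiTheta₂_term_le hτ (by simp) le_rfl n)
    (.of_forall fun t _ => hb) (by simp)
    (.of_forall fun t _ => hasSum_jacobiTheta₂_term t hτ)
  have hn : ∀ n : ℤ, n ≠ 0 → ∫ t in (0 : ℝ)..1, jacobiTheta₂_term n t τ = 0 := by
    intro n hn
    simp only [jacobiTheta₂_term, exp_add, intervalIntegral.integral_mul_const]
    rw [integral_exp_mul_complex (by simp [hn, Real.pi_ne_zero])]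
    have : exp (2 * Real.pi * I * n) = 1 := exp_eq_one_iff.2 ⟨n, by ring⟩
    simp [this]
  have h1 := h.unique (hasSum_single 0 hn)
  simp [h0, jacobiTheta₂_term] at h1

lemma theta1_eq (z τ : ℂ) : theta1 z τ = -I * exp (piC * I * τ / 4) * exp (I * z) *
    jacobiTheta₂ (z / piC + 1 / 2 + τ / 2) τ := by
  rw [theta1, jacobiTheta₂, mul_assoc (_ * _), ← tsum_mul_left (a := exp (I * z))]
  congr 1
  refine tsum_congr fun n => ?_
  have hn : (-1 : ℂ) ^ n = exp (Real.pi * I * n) := by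
    rw [← exp_pi_mul_I, ← exp_int_mul, mul_comm]
  rw [jacobiTheta₂_term, hn, ← exp_add, ← exp_add, ← exp_add]
  congr 1
  have h0 := piC_ne_zero
  rw [show (Real.pi : ℂ) = piC from rfl]
  field_simp
  ring

lemma theta1_add_pi (z τ : ℂ) : theta1 (z + piC) τ = -theta1 z τ := by
  have h1 : exp (I * (z + piC)) = -exp (I * z) := by
    rw [show I * (z + piC) = I * z + Real.pi * I by simp only [piC]; ring, exp_add, exp_pi_mul_I]
    ring
  rw [theta1_eq, theta1_eq, h1, add_div, div_self piC_ne_zero,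
    show z / piC + 1 + 1 / 2 + τ / 2 = z / piC + 1 / 2 + τ / 2 + 1 by ring, jacobiTheta₂_add_left]
  ring

lemma theta1_add_tau (z τ : ℂ) : theta1 (z + piC * τ) τ =
    -exp (-(I * piC * τ)) * exp (-(2 * I * z)) * theta1 z τ := by
  have h0 := piC_ne_zero
  have h1 : -(Real.pi : ℂ) * I * (τ + 2 * (z / piC + 1 / 2 + τ / 2)) =
      -(2 * I * z) - 2 * (I * piC * τ) - Real.pi * I := by
    rw [show (Real.pi : ℂ) = piC from rfl]
    field_simp
    ring
  have h2 : exp (I * (z + piC * τ)) = exp (I * z) * exp (I * piC * τ) := by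
    rw [← exp_add]; ring_nf
  have h3 : exp (-(2 * I * z) - 2 * (I * piC * τ) - Real.pi * I) =
      -exp (-(2 * I * z)) * (exp (-(I * piC * τ)) * exp (-(I * piC * τ))) := by
    rw [exp_sub, exp_pi_mul_I, ← exp_add, neg_mul, ← exp_add]
    ring_nf
  have h4 : exp (I * piC * τ) * exp (-(I * piC * τ)) = 1 := by rw [← exp_add]; simp
  rw [theta1_eq, theta1_eq, h2, add_div, mul_div_cancel_left₀ _ h0,
    show z / piC + τ + 1 / 2 + τ / 2 = z / piC + 1 / 2 + τ / 2 + τ by ring,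
    jacobiTheta₂_add_left', h1, h3]
  linear_combination (I * exp (piC * I * τ / 4) * exp (I * z) * exp (-(I * piC * τ)) *
    exp (-(2 * I * z)) * jacobiTheta₂ (z / piC + 1 / 2 + τ / 2) τ) * h4

lemma differentiable_theta1 {τ : ℂ} (hτ : 0 < τ.im) : Differentiable ℂ fun z => theta1 z τ := by
  have h : Differentiable ℂ (jacobiTheta₂ · τ) := fun z => differentiableAt_jacobiTheta₂_fst z hτ
  simp only [theta1_eq]
  exact (by fun_prop : Differentiable ℂ fun z => -I * exp (piC * I * τ / 4) * exp (I * z)).mul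
    (h.comp (by fun_prop : Differentiable ℂ fun z => z / piC + 1 / 2 + τ / 2))

lemma theta1_zero (τ : ℂ) : theta1 0 τ = 0 := by
  have h1 : jacobiTheta₂ (1 / 2 + τ / 2) τ = -jacobiTheta₂ (1 / 2 + τ / 2) τ := by
    conv_lhs => rw [show 1 / 2 + τ / 2 = -(1 / 2 + τ / 2) + τ + 1 by ring, jacobiTheta₂_add_left,
      jacobiTheta₂_add_left', jacobiTheta₂_neg_left,
      show -(Real.pi : ℂ) * I * (τ + 2 * -(1 / 2 + τ / 2)) = Real.pi * I by ring, exp_pi_mul_I]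
    ring
  rw [theta1_eq, zero_div, zero_add, self_eq_neg.1 h1, mul_zero]

lemma exists_theta1_ne_zero {τ : ℂ} (hτ : 0 < τ.im) : ∃ z, theta1 z τ ≠ 0 := by
  obtain ⟨w, hw⟩ := jacobiTheta₂_ne_zero hτ
  refine ⟨(w - 1 / 2 - τ / 2) * piC, ?_⟩
  rw [theta1_eq, mul_div_cancel_right₀ _ piC_ne_zero,
    show w - 1 / 2 - τ / 2 + 1 / 2 + τ / 2 = w by ring]
  simp [exp_ne_zero, hw]

lemma exists_theta1_eq_mul_sigmaProd {τ : ℂ} (hτ : 0 < τ.im) :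
    ∃ c : ℂ, c ≠ 0 ∧ ∀ z, theta1 z τ = c * sigmaProd τ z := by
  have hP := isSigma_sigmaProd hτ
  have hT := differentiable_theta1 hτ
  have hz : ∀ z ∈ Lambda τ, theta1 z τ = 0 := fun z hz => by
    have := iff_of_mem_Lambda (P := fun z => theta1 z τ = 0) (fun z => by simp [theta1_add_pi])
      (fun z => by simp [theta1_add_tau, exp_ne_zero]) hz 0
    rw [zero_add] at this
    exact this.2 (theta1_zero τ)
  obtain ⟨E, hE, e⟩ := exists_entire_of_extendable (G := fun z => theta1 z τ / sigmaProd τ z)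
    fun p => by
      by_cases hp : p ∈ Lambda τ
      · simpa [hz p hp] using extendable_div_sub_simple_pole (hT.analyticAt p)
          (hP.differentiable.analyticAt p) ((hP.eq_zero_iff p).2 hp) (hP.deriv_ne_zero_of_mem hp)
      · exact .of_analyticAt ((hT.analyticAt p).div (hP.differentiable.analyticAt p)
          (mt (hP.eq_zero_iff p).1 hp))
  have hc := hE.continuous
  obtain ⟨c, hc⟩ := eq_const_of_doubly_periodic hτ hE
    (eq_of_eventuallyEq_nhdsNE (by fun_prop) hc fun p => by
      filter_upwards [e p, eventuallyEq_shift (e (p + piC))] with z a b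
      rw [← a, ← b, theta1_add_pi, hP.add_pi, neg_div_neg_eq])
    (eq_of_eventuallyEq_nhdsNE (G := fun z => E (z + piC * τ)) (by fun_prop) hc fun p => by
      filter_upwards [e p, eventuallyEq_shift (e (p + piC * τ))] with z a b
      rw [← a, ← b, theta1_add_tau, hP.add_tau,
        mul_div_mul_left _ _ (mul_ne_zero (neg_ne_zero.2 (exp_ne_zero _)) (exp_ne_zero _))])
  have hmul : ∀ z, theta1 z τ = c * sigmaProd τ z := by
    have := hP.differentiable.continuous
    refine eq_of_eventuallyEq_nhdsNE hT.continuous (by fun_prop) fun p => ?_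
    filter_upwards [e p, hP.eventually_ne_zero p] with z a b
    rw [hc, div_eq_iff b] at a
    exact a
  refine ⟨c, fun h => ?_, hmul⟩
  obtain ⟨z, hz⟩ := exists_theta1_ne_zero hτ
  exact hz (by rw [hmul, h, zero_mul])

lemma isSigma_theta1 {τ : ℂ} (hτ : 0 < τ.im) : IsSigma τ fun z => theta1 z τ := by
  have hP := isSigma_sigmaProd hτ
  obtain ⟨c, hc, h⟩ := exists_theta1_eq_mul_sigmaProd hτ
  refine ⟨differentiable_theta1 hτ, fun z => theta1_add_pi z τ, fun z => theta1_add_tau z τ,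
    fun z hz => hP.mem_of_eq_zero z ?_, theta1_zero τ, ?_⟩
  · simpa [h, hc] using hz
  · simp only [h]
    rw [deriv_const_mul _ (hP.differentiable 0)]
    exact mul_ne_zero hc hP.deriv_ne_zero

/-! ### Values of `θ₁` at the half periods -/

lemma summable_jacobiTheta₂_term {τ : ℂ} (hτ : 0 < τ.im) (z : ℂ) :
    Summable (jacobiTheta₂_term · z τ) := (summable_jacobiTheta₂_term_iff z τ).2 hτ

lemma jacobiTheta₂_eq_one_add {τ z : ℂ} (hτ : 0 < τ.im)
    (he : Function.Even (jacobiTheta₂_term · z τ)) :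
    jacobiTheta₂ z τ = 1 + 2 * ∑' n : ℕ, jacobiTheta₂_term (n + 1) z τ := by
  rw [jacobiTheta₂, tsum_int_eq_zero_add_two_mul_tsum_pnat he (summable_jacobiTheta₂_term hτ z),
    tsum_pnat_eq_tsum_succ (f := fun n : ℕ => jacobiTheta₂_term n z τ)]
  simp [jacobiTheta₂_term]

lemma theta3_zero {τ : ℂ} (hτ : 0 < τ.im) : theta3 0 τ = jacobiTheta₂ 0 τ := by
  rw [jacobiTheta₂_eq_one_add hτ fun n => by simp [jacobiTheta₂_term], theta3]
  congr 2
  refine tsum_congr fun n => ?_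
  rw [jacobiTheta₂_term, piC, mul_zero, cos_zero, mul_one]
  congr 1
  push_cast
  ring

lemma exp_pi_mul_I_mul_int (n : ℤ) : exp (Real.pi * I * n) = (-1) ^ n := by
  rw [mul_comm, exp_int_mul, exp_pi_mul_I]

lemma theta4_zero {τ : ℂ} (hτ : 0 < τ.im) : theta4 0 τ = jacobiTheta₂ (1 / 2) τ := by
  have h : ∀ n : ℤ, jacobiTheta₂_term n (1 / 2) τ =
      (-1) ^ n * exp (Real.pi * I * n ^ 2 * τ) := fun n => by
    rw [jacobiTheta₂_term, exp_add, ← exp_pi_mul_I_mul_int]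
    ring_nf
  rw [jacobiTheta₂_eq_one_add hτ fun n => by simp only [h]; simp [← inv_zpow], theta4]
  congr 2
  refine tsum_congr fun n => ?_
  rw [h, piC, mul_zero, cos_zero, mul_one]
  congr 2
  push_cast
  ring

lemma jacobiTheta₂_half_tau {τ : ℂ} (hτ : 0 < τ.im) :
    jacobiTheta₂ (τ / 2) τ = 2 * ∑' n : ℕ, jacobiTheta₂_term n (τ / 2) τ := by
  have hneg : ∀ n : ℕ, jacobiTheta₂_term (-(n + 1)) (τ / 2) τ = jacobiTheta₂_term n (τ / 2) τ :=
    fun n => by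
      rw [jacobiTheta₂_term, jacobiTheta₂_term]
      congr 1
      push_cast
      ring
  have h1 : Summable fun n : ℕ => jacobiTheta₂_term n (τ / 2) τ :=
    (summable_jacobiTheta₂_term hτ (τ / 2)).comp_injective (i := ((↑) : ℕ → ℤ)) Nat.cast_injective
  have h2 : Summable fun n : ℕ => jacobiTheta₂_term (-(n + 1)) (τ / 2) τ := by
    simpa only [hneg] using h1
  have h3 := tsum_of_nat_of_neg_add_one (f := fun n => jacobiTheta₂_term n (τ / 2) τ) h1 h2
  rw [jacobiTheta₂, h3, tsum_congr hneg, ← two_mul]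

lemma theta2_zero {τ : ℂ} (hτ : 0 < τ.im) :
    theta2 0 τ = exp (piC * I * τ / 4) * jacobiTheta₂ (τ / 2) τ := by
  rw [jacobiTheta₂_half_tau hτ, theta2, mul_left_comm,
    ← tsum_mul_left (a := exp (piC * I * τ / 4))]
  congr 1
  refine tsum_congr fun n => ?_
  rw [jacobiTheta₂_term, ← exp_add, mul_zero, cos_zero, mul_one, piC]
  congr 1
  push_cast
  ring

lemma theta1_half_pi {τ : ℂ} (hτ : 0 < τ.im) : theta1 (piC / 2) τ = theta2 0 τ := by
  have h : exp (I * (piC / 2)) = I := by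
    rw [show I * (piC / 2) = Real.pi / 2 * I by rw [piC]; ring, exp_pi_div_two_mul_I]
  rw [theta1_eq, theta2_zero hτ, h, div_right_comm, div_self piC_ne_zero,
    show (1 : ℂ) / 2 + 1 / 2 + τ / 2 = τ / 2 + 1 by ring, jacobiTheta₂_add_left]
  linear_combination (-exp (piC * I * τ / 4) * jacobiTheta₂ (τ / 2) τ) * I_sq

lemma theta1_half_pi_add_tau {τ : ℂ} (hτ : 0 < τ.im) :
    theta1 ((piC + piC * τ) / 2) τ = exp (-(piC * I * τ / 4)) * theta3 0 τ := by
  have h : exp (I * ((piC + piC * τ) / 2)) = I * exp (I * (piC * τ) / 2) := by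
    rw [show I * ((piC + piC * τ) / 2) = Real.pi / 2 * I + I * (piC * τ) / 2 by rw [piC]; ring,
      exp_add, exp_pi_div_two_mul_I]
  have h2 : (piC + piC * τ) / 2 / piC + 1 / 2 + τ / 2 = 0 + τ + 1 := by
    have := piC_ne_zero
    field_simp
    ring
  have h3 : exp (piC * I * τ / 4) * exp (I * (piC * τ) / 2) *
      exp (-Real.pi * I * (τ + 2 * 0)) = exp (-(piC * I * τ / 4)) := by
    rw [← exp_add, ← exp_add, piC]
    ring_nf
  rw [theta1_eq, h, h2, jacobiTheta₂_add_left, jacobiTheta₂_add_left', theta3_zero hτ, ← h3]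
  linear_combination (-exp (piC * I * τ / 4) * exp (I * (piC * τ) / 2) *
      exp (-Real.pi * I * (τ + 2 * 0)) * jacobiTheta₂ 0 τ) * I_sq

lemma theta1_half_tau {τ : ℂ} (hτ : 0 < τ.im) :
    theta1 (piC * τ / 2) τ = I * exp (-(piC * I * τ / 4)) * theta4 0 τ := by
  have h2 : piC * τ / 2 / piC + 1 / 2 + τ / 2 = 1 / 2 + τ := by
    have := piC_ne_zero
    field_simp
    ring
  have h3 : exp (piC * I * τ / 4) * exp (I * (piC * τ / 2)) *
      exp (-Real.pi * I * (τ + 2 * (1 / 2))) = -exp (-(piC * I * τ / 4)) := by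
    rw [← exp_add, ← exp_add, piC, show Real.pi * I * τ / 4 + I * (Real.pi * τ / 2) +
      -Real.pi * I * (τ + 2 * (1 / 2)) = -(Real.pi * I * τ / 4) - Real.pi * I by ring, exp_sub,
      exp_pi_mul_I]
    ring
  rw [theta1_eq, h2, jacobiTheta₂_add_left', theta4_zero hτ]
  linear_combination (-I * jacobiTheta₂ (1 / 2) τ) * h3

/-! ### The logarithm of the sigma product -/

/-- The coefficients of the power series of `log ∏ (1 - q ^ (n + 1) * w)`. -/
def logCoeff (q : ℂ) (m : ℕ) : ℂ := -(q ^ (m + 1) / ((m + 1) * (1 - q ^ (m + 1))))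

lemma summable_prod_log_terms {q w : ℂ} (hq : ‖q‖ < 1) (hw : ‖q * w‖ < 1) :
    Summable (Function.uncurry fun n m : ℕ => (q ^ n * (q * w)) ^ (m + 1) / ((m : ℂ) + 1)) := by
  have h := ((summable_geometric_of_lt_one (norm_nonneg _) hq).mul_of_nonneg
    (summable_geometric_of_lt_one (norm_nonneg _) hw) (fun n => by positivity)
    fun n => by positivity)
  refine h.of_norm_bounded fun ⟨n, m⟩ => ?_
  have h1 : 1 ≤ ‖(m : ℂ) + 1‖ := by
    rw [← Nat.cast_succ, Complex.norm_natCast]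
    exact_mod_cast Nat.succ_le_succ m.zero_le
  rw [Function.uncurry_apply_pair, norm_div]
  refine (div_le_self (norm_nonneg _) h1).trans ?_
  rw [norm_pow, norm_mul, norm_pow, mul_pow, ← pow_mul]
  gcongr ?_ * ?_
  · exact pow_le_pow_of_le_one (norm_nonneg _) hq.le (Nat.le_mul_of_pos_right n m.succ_pos)
  · exact pow_le_pow_of_le_one (norm_nonneg _) hw.le m.le_succ

lemma qProd_mul_eq_exp {q w : ℂ} (hq : ‖q‖ < 1) (hw : ‖q * w‖ < 1) :
    qProd q (q * w) = exp (∑' m, logCoeff q m * w ^ (m + 1)) := by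
  have hlt : ∀ n : ℕ, ‖q ^ n * (q * w)‖ < 1 := fun n => by
    rw [norm_mul, norm_pow]
    exact mul_lt_one_of_nonneg_of_lt_one_right (pow_le_one₀ (norm_nonneg _) hq.le)
      (norm_nonneg _) hw
  have hne : ∀ n : ℕ, 1 - q ^ n * (q * w) ≠ 0 := fun n h => by
    have := hlt n
    rw [← sub_eq_zero.1 h, norm_one] at this
    exact this.false
  have hsum : Summable fun n : ℕ => log (1 - q ^ n * (q * w)) := by
    simpa [sub_eq_add_neg] using summable_log_one_add_of_summable
      (f := fun n : ℕ => -(q ^ n * (q * w))) (summable_norm_pow_mul hq (q * w)).of_norm.neg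
  rw [qProd, ← cexp_tsum_eq_tprod hne hsum]
  congr 1
  calc ∑' n : ℕ, log (1 - q ^ n * (q * w))
      = ∑' n : ℕ, -∑' m : ℕ, (q ^ n * (q * w)) ^ (m + 1) / ((m : ℂ) + 1) :=
        tsum_congr fun n => by rw [(hasSum_taylorSeries_neg_log' (hlt n)).tsum_eq, neg_neg]
    _ = ∑' m : ℕ, -∑' n : ℕ, (q ^ n * (q * w)) ^ (m + 1) / ((m : ℂ) + 1) := by
        rw [tsum_neg, ← (summable_prod_log_terms hq hw).tsum_comm, tsum_neg]
    _ = _ := tsum_congr fun m => by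
        have hqm : ‖q ^ (m + 1)‖ < 1 := by
          rw [norm_pow]
          exact pow_lt_one₀ (norm_nonneg _) hq m.succ_ne_zero
        have e : ∀ n : ℕ, (q ^ n * (q * w)) ^ (m + 1) / ((m : ℂ) + 1) =
            (q ^ (m + 1)) ^ n * ((q * w) ^ (m + 1) / ((m : ℂ) + 1)) := fun n => by ring
        simp only [e]
        rw [tsum_mul_right, tsum_geometric_of_norm_lt_one hqm, logCoeff, mul_pow]
        have h1 : (m : ℂ) + 1 ≠ 0 := m.cast_add_one_ne_zero
        have h2 : 1 - q ^ (m + 1) ≠ 0 := fun h => by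
          rw [← sub_eq_zero.1 h, norm_one] at hqm
          exact hqm.false
        field_simp

/-- The exponential series `∑ c m * e^{2i(m + 1)z}`. -/
def expSeries (c : ℕ → ℂ) (z : ℂ) : ℂ := ∑' m, c m * exp (2 * I * z) ^ (m + 1)

/-- Coefficients decaying fast enough for the exponential series and all its derivatives to
converge normally where `‖e^{2iz}‖ < R`. -/
def RapidDecay (R : ℝ) (c : ℕ → ℂ) : Prop :=
  ∀ k : ℕ, Summable fun m : ℕ => ‖c m‖ * (m + 1 : ℝ) ^ k * R ^ (m + 1)

lemma RapidDecay.mul {R : ℝ} {c : ℕ → ℂ} (hc : RapidDecay R c) :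
    RapidDecay R fun m => c m * (2 * I * (m + 1)) := fun k => by
  refine ((hc (k + 1)).mul_left 2).congr fun m => ?_
  have h : ‖(m : ℂ) + 1‖ = m + 1 := by rw [← Nat.cast_succ, Complex.norm_natCast, Nat.cast_succ]
  simp only [norm_mul, norm_I, h, Complex.norm_ofNat]
  ring

lemma RapidDecay.hasSum_deriv {R : ℝ} {c : ℕ → ℂ} (hc : RapidDecay R c) {z : ℂ}
    (hz : ‖exp (2 * I * z)‖ < R) : DifferentiableAt ℂ (expSeries c) z ∧
      deriv (expSeries c) z = expSeries (fun m => c m * (2 * I * (m + 1))) z := by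
  have hU : IsOpen {z : ℂ | ‖exp (2 * I * z)‖ < R} :=
    isOpen_lt (by fun_prop) continuous_const
  have hb : ∀ (m : ℕ) (w : ℂ), w ∈ {z : ℂ | ‖exp (2 * I * z)‖ < R} →
      ‖c m * exp (2 * I * w) ^ (m + 1)‖ ≤ ‖c m‖ * (m + 1 : ℝ) ^ 0 * R ^ (m + 1) := by
    intro m w hw
    have hw : ‖exp (2 * I * w)‖ < R := hw
    rw [norm_mul, norm_pow, pow_zero, mul_one]
    gcongr
  have hd : ∀ m : ℕ, Differentiable ℂ fun w => c m * exp (2 * I * w) ^ (m + 1) := fun m => by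
    fun_prop
  refine ⟨(differentiableOn_tsum_of_summable_norm (hc 0) (fun m => (hd m).differentiableOn) hU
    hb).differentiableAt (hU.mem_nhds hz), ?_⟩
  have h := hasSum_deriv_of_summable_norm (hc 0) (fun m => (hd m).differentiableOn) hU hb hz
  refine h.tsum_eq.symm.trans (tsum_congr fun m => ?_)
  have h1 : HasDerivAt (fun w : ℂ => exp (2 * I * w)) (exp (2 * I * z) * (2 * I)) z := by
    simpa using ((hasDerivAt_id z).const_mul (2 * I)).cexp
  rw [((h1.fun_pow (m + 1)).const_mul (c m)).deriv]
  push_cast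
  ring

lemma RapidDecay.iteratedDeriv_eq {R : ℝ} (k : ℕ) : ∀ {c : ℕ → ℂ}, RapidDecay R c → ∀ {z : ℂ},
    ‖exp (2 * I * z)‖ < R → iteratedDeriv k (expSeries c) z =
      expSeries (fun m => c m * (2 * I * (m + 1)) ^ k) z := by
  induction k with
  | zero => intro c _ z _; simp
  | succ k ih =>
    intro c hc z hz
    have hU : IsOpen {z : ℂ | ‖exp (2 * I * z)‖ < R} :=
      isOpen_lt (by fun_prop) continuous_const
    have e : deriv (expSeries c) =ᶠ[𝓝 z] expSeries fun m => c m * (2 * I * (m + 1)) :=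
      (hU.eventually_mem hz).mono fun w hw => (hc.hasSum_deriv hw).2
    rw [iteratedDeriv_succ', e.iteratedDeriv_eq, ih hc.mul hz]
    simp only [pow_succ', mul_assoc]

lemma RapidDecay.analyticAt {R : ℝ} {c : ℕ → ℂ} (hc : RapidDecay R c) {z : ℂ}
    (hz : ‖exp (2 * I * z)‖ < R) : AnalyticAt ℂ (expSeries c) z := by
  have hU : IsOpen {z : ℂ | ‖exp (2 * I * z)‖ < R} := isOpen_lt (by fun_prop) continuous_const
  exact DifferentiableOn.analyticAt
    (fun w hw => (hc.hasSum_deriv hw).1.differentiableWithinAt) (hU.mem_nhds hz)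

lemma rapidDecay_logCoeff {q : ℂ} {R : ℝ} (hq : ‖q‖ < 1) (hR : 0 ≤ R) (h : ‖q‖ * R < 1) :
    RapidDecay R (logCoeff q) := fun k => by
  have h1 := (summable_nat_add_iff 1).2 (summable_pow_mul_geometric_of_norm_lt_one k
    (r := ‖q‖ * R) (by rwa [norm_mul, norm_norm, Real.norm_of_nonneg hR]))
  refine (h1.mul_left (1 - ‖q‖)⁻¹).of_nonneg_of_le (fun m => by positivity) fun m => ?_
  have h2 : ‖logCoeff q m‖ ≤ (1 - ‖q‖)⁻¹ * ‖q‖ ^ (m + 1) := by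
    have h3 : 1 - ‖q‖ ≤ ‖1 - q ^ (m + 1)‖ := by
      have := norm_sub_norm_le (1 : ℂ) (q ^ (m + 1))
      rw [norm_one, norm_pow] at this
      have : ‖q‖ ^ (m + 1) ≤ ‖q‖ := pow_le_of_le_one (norm_nonneg q) hq.le m.succ_ne_zero
      linarith
    have h4 : 1 ≤ ‖(m : ℂ) + 1‖ := by
      rw [← Nat.cast_succ, Complex.norm_natCast]
      exact_mod_cast Nat.succ_le_succ m.zero_le
    have h5 : 0 < 1 - ‖q‖ := by linarith
    rw [logCoeff, norm_neg, norm_div, norm_pow, norm_mul, inv_mul_eq_div]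
    gcongr
    nlinarith
  calc _ ≤ (1 - ‖q‖)⁻¹ * ‖q‖ ^ (m + 1) * (m + 1 : ℝ) ^ k * R ^ (m + 1) := by gcongr
    _ = _ := by push_cast; ring

/-! ### Taylor coefficients of logarithms -/

lemma iteratedDeriv_cexp_comp {φ : ℂ → ℂ} {z : ℂ} (hφ : AnalyticAt ℂ φ z) (n : ℕ) :
    iteratedDeriv (n + 1) (fun w => exp (φ w)) z = ∑ i ∈ Finset.range (n + 1), n.choose i *
      iteratedDeriv i (fun w => exp (φ w)) z * iteratedDeriv (n - i + 1) φ z := by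
  have e : deriv (fun w => exp (φ w)) =ᶠ[𝓝 z] fun w => exp (φ w) * deriv φ w :=
    hφ.eventually_analyticAt.mono fun w hw => hw.differentiableAt.hasDerivAt.cexp.deriv
  rw [iteratedDeriv_succ', e.iteratedDeriv_eq,
    iteratedDeriv_fun_mul (f := fun w => exp (φ w)) hφ.cexp.contDiffAt hφ.deriv.contDiffAt]
  simp only [iteratedDeriv_succ']

/-- The derivatives of `exp ∘ φ` up to order four at a critical point of `φ`. -/
lemma iteratedDeriv_cexp_comp_of_critical {φ : ℂ → ℂ} {z : ℂ} (hφ : AnalyticAt ℂ φ z)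
    (h : iteratedDeriv 1 φ z = 0) :
    iteratedDeriv 1 (fun w => exp (φ w)) z = 0 ∧
    iteratedDeriv 2 (fun w => exp (φ w)) z = exp (φ z) * iteratedDeriv 2 φ z ∧
    iteratedDeriv 4 (fun w => exp (φ w)) z =
      exp (φ z) * (iteratedDeriv 4 φ z + 3 * iteratedDeriv 2 φ z ^ 2) := by
  have h1 := iteratedDeriv_cexp_comp hφ 0
  have h2 := iteratedDeriv_cexp_comp hφ 1
  have h3 := iteratedDeriv_cexp_comp hφ 2
  have h4 := iteratedDeriv_cexp_comp hφ 3
  simp only [Finset.sum_range_succ, Finset.sum_range_zero, iteratedDeriv_zero, Nat.reduceAdd,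
    Nat.reduceSub, Nat.choose, Nat.cast_one, h] at h1 h2 h3 h4
  norm_num at h1 h2 h3 h4
  rw [h1] at h4
  rw [h2] at h4
  exact ⟨by rw [iteratedDeriv_one, h1], h2, by rw [h4]; ring⟩

lemma iteratedDeriv_sin_zero_eq {s : ℂ → ℂ} (hs : AnalyticAt ℂ s 0)
    (h : ∀ z, Complex.sin z = z * s z) (n : ℕ) :
    iteratedDeriv (n + 1) Complex.sin 0 = (n + 1) * iteratedDeriv n s 0 := by
  have e : Complex.sin = fun z => z * s z := funext h
  rw [e, iteratedDeriv_fun_mul (f := fun z => z) analyticAt_id.contDiffAt hs.contDiffAt,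
    Finset.sum_eq_single_of_mem 1 (by simp)]
  · simp [iteratedDeriv_one]
  · intro i _ hi
    rcases i with _ | _ | i
    · simp
    · simp at hi
    · simp [iteratedDeriv_succ', iteratedDeriv_const]

/-- A holomorphic logarithm of `sin z / z` near the origin, with its derivatives. -/
lemma exists_log_sin_div : ∃ l : ℂ → ℂ, AnalyticAt ℂ l 0 ∧
    (∀ᶠ z in 𝓝 0, Complex.sin z = z * exp (l z)) ∧ iteratedDeriv 1 l 0 = 0 ∧
    iteratedDeriv 2 l 0 = -1 / 3 ∧ iteratedDeriv 4 l 0 = -2 / 15 := by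
  set s := dslope Complex.sin 0 with hs
  have hmul : ∀ z, Complex.sin z = z * s z := fun z => by
    simpa using (sub_smul_dslope Complex.sin 0 z).symm
  have hsa : AnalyticAt ℂ s 0 := by
    have : DifferentiableOn ℂ s Set.univ := (Complex.differentiableOn_dslope Filter.univ_mem).2
      Complex.differentiable_sin.differentiableOn
    exact this.analyticAt Filter.univ_mem
  have hd := iteratedDeriv_sin_zero_eq hsa hmul
  have h0 : s 0 = 1 := by simp [hs]
  have hsin : ∀ n, iteratedDeriv (n + 2) Complex.sin 0 = -iteratedDeriv n Complex.sin 0 := by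
    intro n
    rw [Complex.iteratedDeriv_add_one_sin, Complex.iteratedDeriv_add_one_cos]
    simp
  have hs1 : iteratedDeriv 1 s 0 = 0 := by
    have h := hd 1
    rw [hsin 0] at h
    simpa using h
  have hs2 : iteratedDeriv 2 s 0 = -1 / 3 := by
    have h := hd 2
    rw [hsin 1] at h
    simp [iteratedDeriv_one] at h
    linear_combination -h / 3
  have hs4 : iteratedDeriv 4 s 0 = 1 / 5 := by
    have h := hd 4
    rw [hsin 3, hsin 1] at h
    simp [iteratedDeriv_one] at h
    linear_combination -h / 5
  have hla : AnalyticAt ℂ (fun z => log (s z)) 0 := hsa.clog (by simp [h0])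
  have hexp : (fun z => exp (log (s z))) =ᶠ[𝓝 0] s :=
    (hsa.continuousAt.eventually_ne (by simp [h0])).mono fun z hz => exp_log hz
  have hE : ∀ n, iteratedDeriv n (fun z => exp (log (s z))) 0 = iteratedDeriv n s 0 :=
    fun n => hexp.iteratedDeriv_eq n
  have hl1 : iteratedDeriv 1 (fun z => log (s z)) 0 = 0 := by
    have h := iteratedDeriv_cexp_comp hla 0
    rw [hE, hs1] at h
    simpa [h0] using h.symm
  obtain ⟨-, hl2, hl4⟩ := iteratedDeriv_cexp_comp_of_critical hla hl1
  simp only [hE, h0, log_one, exp_zero, one_mul, hs2, hs4] at hl2 hl4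
  refine ⟨fun z => log (s z), hla, hexp.mono fun z hz => ?_, hl1, hl2.symm, ?_⟩
  · rw [hmul, ← hz]
  · rw [← hl2] at hl4
    linear_combination -hl4

lemma iteratedDeriv_comp_mul_left (c : ℂ) (n : ℕ) : ∀ (φ : ℂ → ℂ) (z : ℂ),
    iteratedDeriv n (fun w => φ (c * w)) z = c ^ n * iteratedDeriv n φ (c * z) := by
  induction n with
  | zero => simp
  | succ n ih =>
    intro φ z
    have e : deriv (fun w => φ (c * w)) = fun w => c * deriv φ (c * w) :=
      funext fun w => deriv_comp_mul_left c φ w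
    rw [iteratedDeriv_succ', e, iteratedDeriv_const_mul_field, ih, iteratedDeriv_succ']
    ring

/-- A holomorphic logarithm of the regular factor of the sigma product near the origin, with its
derivatives. -/
lemma exists_log_regularProd {τ : ℂ} (hτ : 0 < τ.im) : ∃ l : ℂ → ℂ, AnalyticAt ℂ l 0 ∧
    (∀ᶠ z in 𝓝 0, regularProd τ z = exp (l z)) ∧ iteratedDeriv 1 l 0 = 0 ∧
    iteratedDeriv 2 l 0 = (1 - EisL τ) / 3 ∧ iteratedDeriv 4 l 0 = 2 * (1 - EisM τ) / 15 := by
  have hq := norm_qq_lt_one hτ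
  obtain ⟨R, hR1, hR⟩ : ∃ R : ℝ, 1 < R ∧ ‖qq τ‖ * R < 1 := by
    have h : ∀ᶠ R in 𝓝[>] (1 : ℝ), ‖qq τ‖ * R < 1 :=
      (((continuous_const.mul continuous_id).tendsto' (1 : ℝ) ‖qq τ‖ (by simp)).eventually_lt_const
        hq).filter_mono nhdsWithin_le_nhds
    obtain ⟨R, h1, h2⟩ := (h.and self_mem_nhdsWithin).exists
    exact ⟨R, h2, h1⟩
  have hc := rapidDecay_logCoeff hq (by linarith) hR
  have hE0 : ‖exp (2 * I * 0)‖ < R := by simpa using hR1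
  set ψ := expSeries (logCoeff (qq τ)) with hψ
  have hψa : AnalyticAt ℂ ψ 0 := hc.analyticAt hE0
  have hψn : AnalyticAt ℂ (fun z => ψ (-z)) 0 :=
    AnalyticAt.fun_comp (by simpa using hψa) analyticAt_id.neg
  have hD : ∀ n, iteratedDeriv n (fun z => ψ z + ψ (-z)) 0 =
      (1 + (-1) ^ n) * ∑' m : ℕ, logCoeff (qq τ) m * (2 * I * (m + 1)) ^ n := by
    intro n
    rw [iteratedDeriv_fun_add hψa.contDiffAt hψn.contDiffAt, iteratedDeriv_comp_neg, neg_zero,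
      hc.iteratedDeriv_eq n hE0]
    simp only [expSeries, mul_zero, exp_zero, one_pow, mul_one, smul_eq_mul]
    ring
  have hne : ∀ m : ℕ, 1 - qq τ ^ (m + 1) ≠ 0 := fun m h => by
    have : ‖qq τ ^ (m + 1)‖ < 1 := by
      rw [norm_pow]
      exact pow_lt_one₀ (norm_nonneg _) hq m.succ_ne_zero
    rw [← sub_eq_zero.1 h, norm_one] at this
    exact this.false
  refine ⟨fun z => ψ z + ψ (-z), hψa.add hψn, ?_, ?_, ?_, ?_⟩
  · have h : ∀ᶠ z in 𝓝 (0 : ℂ), ‖exp (2 * I * z)‖ < R ∧ ‖exp (-(2 * I * z))‖ < R := by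
      refine Eventually.and ?_ ?_ <;>
      · refine ContinuousAt.eventually_lt (by fun_prop) continuousAt_const ?_
        simpa using hR1
    filter_upwards [h] with z hz
    have hlt : ∀ w, ‖w‖ < R → ‖qq τ * w‖ < 1 := fun w hw => by
      rw [norm_mul]
      exact (mul_le_mul_of_nonneg_left hw.le (norm_nonneg _)).trans_lt hR
    rw [regularProd, qProd_mul_eq_exp hq (hlt _ hz.1), qProd_mul_eq_exp hq (hlt _ hz.2),
      ← exp_add]
    simp only [hψ, expSeries, mul_neg]
  · rw [hD]
    norm_num
  · rw [hD, EisL, show ∀ S : ℂ, (1 - (1 - 24 * S)) / 3 = 2 * (4 * S) from fun S => by ring,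
      ← tsum_mul_left (a := 4)]
    norm_num
    refine tsum_congr fun m => ?_
    have h1 : (m : ℂ) + 1 ≠ 0 := m.cast_add_one_ne_zero
    have h2 := hne m
    rw [logCoeff, mul_pow, mul_pow, I_sq]
    field_simp
    ring
  · rw [hD, EisM, show ∀ S : ℂ, 2 * (1 - (1 + 240 * S)) / 15 = 2 * (-16 * S) from
      fun S => by ring, ← tsum_mul_left (a := -16)]
    norm_num
    refine tsum_congr fun m => ?_
    have h1 : (m : ℂ) + 1 ≠ 0 := m.cast_add_one_ne_zero
    have h2 := hne m
    rw [logCoeff, mul_pow, mul_pow, I_pow_four]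
    field_simp
    ring

/-! ### The logarithm of `θ₁` and the main theorem -/

/-- A holomorphic logarithm of `θ₁ z / z` near the origin, with its derivatives. -/
lemma exists_log_theta1 {τ : ℂ} (hτ : 0 < τ.im) : ∃ l : ℂ → ℂ, AnalyticAt ℂ l 0 ∧
    (∀ᶠ z in 𝓝 0, theta1 z τ = z * exp (l z)) ∧ iteratedDeriv 1 l 0 = 0 ∧
    iteratedDeriv 2 l 0 = -EisL τ / 3 ∧ iteratedDeriv 4 l 0 = -2 * EisM τ / 15 := by
  obtain ⟨C, hC, hθ⟩ := exists_theta1_eq_mul_sigmaProd hτ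
  obtain ⟨s, hsa, hs, hs1, hs2, hs4⟩ := exists_log_sin_div
  obtain ⟨r, hra, hr, hr1, hr2, hr4⟩ := exists_log_regularProd hτ
  have hD : ∀ n, iteratedDeriv (n + 1) (fun z => log (C * (-2 * I)) + (s z + r z)) 0 =
      iteratedDeriv (n + 1) s 0 + iteratedDeriv (n + 1) r 0 := fun n => by
    have e : deriv (fun z => log (C * (-2 * I)) + (s z + r z)) = deriv fun z => s z + r z :=
      funext fun z => deriv_const_add _
    rw [iteratedDeriv_succ', e, ← iteratedDeriv_succ',
      iteratedDeriv_fun_add hsa.contDiffAt hra.contDiffAt]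
  refine ⟨fun z => log (C * (-2 * I)) + (s z + r z), analyticAt_const.add (hsa.add hra),
    ?_, ?_, ?_, ?_⟩
  · filter_upwards [hs, hr] with z hz1 hz2
    rw [hθ, sigmaProd_eq hτ, hz1, hz2, exp_add, exp_add, exp_log (by simp [hC])]
    ring
  · rw [hD, hs1, hr1, add_zero]
  · rw [hD, hs2, hr2]
    ring
  · rw [hD, hs4, hr4]
    ring

lemma theta1'_eq {τ : ℂ} {l : ℂ → ℂ} (hl : AnalyticAt ℂ l 0)
    (h : ∀ᶠ z in 𝓝 0, theta1 z τ = z * exp (l z)) : theta1' τ = exp (l 0) := by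
  have hd := (hasDerivAt_id' (0 : ℂ)).fun_mul hl.differentiableAt.hasDerivAt.cexp
  rw [theta1', EventuallyEq.deriv_eq h]
  simpa using hd.deriv

lemma iteratedDeriv_one_eq_zero_of_even {f : ℂ → ℂ} (h : ∀ z, f (-z) = f z) :
    iteratedDeriv 1 f 0 = 0 := by
  have e := iteratedDeriv_comp_neg 1 f 0
  simp only [h, neg_zero, pow_one, smul_eq_mul] at e
  linear_combination e / 2

/-- The residue relation of `IsSigma.sum_residues` for `θ₁`, evaluated at the half periods. -/
lemma theta1_sum_residues {τ : ℂ} (hτ : 0 < τ.im) {f : ℂ → ℂ} (hf : Differentiable ℂ f)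
    (hper1 : ∀ z : ℂ, f z = f (z + piC))
    (hper2 : ∀ z : ℂ, f z = qq τ ^ 4 * exp (16 * I * z) * f (z + piC * τ))
    {u : ℂ → ℂ} (hu : AnalyticAt ℂ u 0)
    (hfu : ∀ᶠ z in 𝓝[≠] 0, f z / (theta1 (2 * z) τ * theta1 z τ ^ 4) = u z / z ^ 5) :
    theta1' τ * iteratedDeriv 4 u 0 = 12 * (f (piC / 2) / theta2 0 τ ^ 4
      - qq τ * f ((piC + piC * τ) / 2) / theta3 0 τ ^ 4
      + qq τ * f (piC * τ / 2) / theta4 0 τ ^ 4) := by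
  have hS := isSigma_theta1 hτ
  have hsum := hS.sum_residues hτ hf hper1 hper2 hu hfu
  have e0 : halfPeriod τ 0 = piC / 2 := by simp [halfPeriod, halfA, halfB]
  have e1 : halfPeriod τ 1 = (piC + piC * τ) / 2 := by simp [halfPeriod, halfA, halfB]
  have e2 : halfPeriod τ 2 = piC * τ / 2 := by simp [halfPeriod, halfA, halfB]
  set w := exp (-(piC * I * τ / 4)) with hw
  have hw0 : w ≠ 0 := exp_ne_zero _
  have hw4 : exp (-(I * piC * τ)) = w ^ 4 := by
    rw [hw, ← exp_nat_mul]
    push_cast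
    ring_nf
  have hq : qq τ * w ^ 8 = 1 := by
    rw [hw, qq, ← exp_nat_mul, ← exp_add, ← exp_zero]
    push_cast
    ring_nf
  have hpi : exp (-(2 * I * piC)) = 1 := by
    rw [exp_neg, show 2 * I * piC = 2 * (Real.pi : ℂ) * I by rw [piC]; ring, exp_two_pi_mul_I,
      inv_one]
  have hne : ∀ i, theta1 (halfPeriod τ i) τ ≠ 0 := fun i =>
    mt (hS.eq_zero_iff _).1 (halfPeriod_not_mem hτ i)
  have hp : deriv (fun z => theta1 z τ) 0 = theta1' τ := rfl
  have hp0 : theta1' τ ≠ 0 := hS.deriv_ne_zero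
  have hz : theta1 piC τ = 0 := by
    have := hS.add_pi 0
    simpa [theta1_zero] using this
  have d0 : deriv (fun z => theta1 z τ) piC = -theta1' τ := by
    have := hS.deriv_add_pi 0
    rwa [zero_add, hp] at this
  have d1 : deriv (fun z => theta1 z τ) (piC + piC * τ) = w ^ 4 * theta1' τ := by
    rw [hS.deriv_add_tau, d0, hz, hw4, hpi]
    ring
  have d2 : deriv (fun z => theta1 z τ) (piC * τ) = -w ^ 4 * theta1' τ := by
    have := hS.deriv_add_tau 0
    rw [zero_add, hp, theta1_zero, hw4] at this
    rw [this]
    simp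
  have hn0 := hne 0
  have hn1 := hne 1
  have hn2 := hne 2
  rw [e0, theta1_half_pi hτ] at hn0
  rw [e1, theta1_half_pi_add_tau hτ] at hn1
  rw [e2, theta1_half_tau hτ] at hn2
  have ht3 := right_ne_zero_of_mul hn1
  have ht4 := right_ne_zero_of_mul hn2
  rw [Fin.sum_univ_three, e0, e1, e2, mul_div_cancel₀ _ two_ne_zero, mul_div_cancel₀ _ two_ne_zero,
    mul_div_cancel₀ _ two_ne_zero, theta1_half_pi hτ, theta1_half_pi_add_tau hτ,
    theta1_half_tau hτ, d0, d1, d2, ← hw, mul_pow, mul_pow, mul_pow, I_pow_four] at hsum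
  have hq' : qq τ = (w ^ 8)⁻¹ := eq_inv_of_mul_eq_one_left hq
  rw [hq']
  field_simp at hsum ⊢
  linear_combination hsum / 2

theorem statement1 (τ : ℂ) (hτ : 0 < τ.im) (f : ℂ → ℂ)
    (hf : Differentiable ℂ f)
    (heven : ∀ z : ℂ, f (-z) = f z)
    (hper1 : ∀ z : ℂ, f z = f (z + piC))
    (hper2 : ∀ z : ℂ, f z = qq τ ^ 4 * exp (16 * I * z) * f (z + piC * τ))
    (hf0 : f 0 ≠ 0)
    (g : ℂ → ℂ) (hg : AnalyticAt ℂ g 0)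
    (hgf : ∀ᶠ z in nhds 0, exp (g z) = f z) :
    (8 * EisL τ + 3 * iteratedDeriv 2 g 0) ^ 2 + 8 * EisM τ + 3 * iteratedDeriv 4 g 0 =
      72 * theta1' τ ^ 4 / f 0 *
        (f (piC / 2) / theta2 0 τ ^ 4
          - qq τ * f ((piC + piC * τ) / 2) / theta3 0 τ ^ 4
          + qq τ * f (piC * τ / 2) / theta4 0 τ ^ 4) := by
  obtain ⟨l, hl, hθ, hl1, hl2, hl4⟩ := exists_log_theta1 hτ
  have hp := theta1'_eq hl hθ
  have hl' : AnalyticAt ℂ (fun z => l (2 * z)) 0 :=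
    AnalyticAt.fun_comp (by simpa using hl) (by fun_prop)
  have hl4' : AnalyticAt ℂ (fun z => 4 * l z) 0 := analyticAt_const.mul hl
  set φ : ℂ → ℂ := fun z => g z - l (2 * z) - 4 * l z with hφ
  have hφa : AnalyticAt ℂ φ 0 := (hg.sub hl').sub hl4'
  have hD : ∀ n, iteratedDeriv n φ 0 =
      iteratedDeriv n g 0 - 2 ^ n * iteratedDeriv n l 0 - 4 * iteratedDeriv n l 0 := fun n => by
    rw [hφ, iteratedDeriv_fun_sub (f := fun z => g z - l (2 * z)) (hg.sub hl').contDiffAt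
      hl4'.contDiffAt,
      iteratedDeriv_fun_sub hg.contDiffAt hl'.contDiffAt, iteratedDeriv_comp_mul_left, mul_zero,
      iteratedDeriv_const_mul_field]
  have hg1 : iteratedDeriv 1 g 0 = 0 := by
    have h := iteratedDeriv_cexp_comp hg 0
    have e : (fun z => exp (g z)) =ᶠ[𝓝 0] f := hgf
    rw [e.iteratedDeriv_eq, iteratedDeriv_one_eq_zero_of_even heven] at h
    simpa using h.symm
  have hφ1 : iteratedDeriv 1 φ 0 = 0 := by rw [hD, hg1, hl1]; ring
  obtain ⟨-, -, hE⟩ := iteratedDeriv_cexp_comp_of_critical hφa hφ1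
  have hφ0 : exp (φ 0) * theta1' τ ^ 5 = f 0 := by
    rw [← hgf.self_of_nhds, hp, ← exp_nat_mul, ← exp_add, hφ]
    congr 1
    simp only [mul_zero]
    push_cast
    ring
  have hfu : ∀ᶠ z in 𝓝[≠] (0 : ℂ), f z / (theta1 (2 * z) τ * theta1 z τ ^ 4) =
      (1 / 2 * exp (φ z)) / z ^ 5 := by
    have hθ2 : ∀ᶠ z in 𝓝 (0 : ℂ), theta1 (2 * z) τ = 2 * z * exp (l (2 * z)) :=
      ((continuous_const_mul (2 : ℂ)).tendsto' 0 0 (by simp)).eventually hθ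
    filter_upwards [hθ.filter_mono nhdsWithin_le_nhds, hθ2.filter_mono nhdsWithin_le_nhds,
      hgf.filter_mono nhdsWithin_le_nhds, self_mem_nhdsWithin] with z h1 h2 h3 hz
    have hz : z ≠ 0 := hz
    have h4 : exp (4 * l z) = exp (l z) ^ 4 := by rw [← exp_nat_mul]; norm_num
    have h5 := exp_ne_zero (l z)
    have h6 := exp_ne_zero (l (2 * z))
    rw [h1, h2, ← h3, hφ, exp_sub, exp_sub, h4]
    field_simp
  have hu : AnalyticAt ℂ (fun z => 1 / 2 * exp (φ z)) 0 := analyticAt_const.mul hφa.cexp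
  have hsum := theta1_sum_residues hτ hf hper1 hper2 hu hfu
  rw [iteratedDeriv_const_mul_field, hE, hD, hD, hl2, hl4] at hsum
  set T := f (piC / 2) / theta2 0 τ ^ 4 - qq τ * f ((piC + piC * τ) / 2) / theta3 0 τ ^ 4
    + qq τ * f (piC * τ / 2) / theta4 0 τ ^ 4
  rw [eq_comm, div_mul_eq_mul_div, div_eq_iff hf0, ← hφ0]
  linear_combination -6 * theta1' τ ^ 4 * hsum
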